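/- arXiv:1105.4322 — 5 statements merged into one kernel-verified Lean document; each statement's English description precedes it below -/
import Mathlib

section
/- Let A ∈ ℤ^{d×n} be a unimodular matrix of rank d. Then there exist a nonsingular integer matrix B ∈ ℤ^{d×d} (det B ≠ 0) and an integer matrix A' ∈ ℤ^{d×n} such that A = B·A' and A' is a unimodular matrix of rank d with δ(A') = 1. -/
/-- By Cramer's rule, if a nonzero maximal minor of a matrix divides all the maximal minors, then
the corresponding square submatrix is a left factor of the matrix. -/
theorem exists_eq_submatrix_mul {R m n : Type*} [CommRing R] [IsDomain R] [Fintype m]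
    [DecidableEq m] (A : Matrix m n R) (τ : m → n) (hτ : (A.submatrix id τ).det ≠ 0)
    (hdvd : ∀ σ : m → n, (A.submatrix id τ).det ∣ (A.submatrix id σ).det) :
    ∃ A' : Matrix m n R, A = A.submatrix id τ * A' := by
  have hcramer (i : m) (j : n) :
      (A.submatrix id τ).det ∣ ((A.submatrix id τ).adjugate * A) i j := by
    convert hdvd (Function.update τ i j) using 1
    change ((A.submatrix id τ).adjugate.mulVec (A.col j)) i = _
    rw [← Matrix.cramer_eq_adjugate_mulVec, Matrix.cramer_apply]
    congr 1
    ext k l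
    by_cases hl : l = i
    · subst hl
      simp
    · simp [hl]
  choose A' hA' using hcramer
  have hadj : (A.submatrix id τ).adjugate * A =
      (A.submatrix id τ).det • (Matrix.of A' : Matrix m n R) := by
    ext i j
    simp [hA']
  have hsmul : (A.submatrix id τ).det • A =
      (A.submatrix id τ).det • (A.submatrix id τ * Matrix.of A') := by
    rw [← Matrix.mul_smul, ← hadj, ← Matrix.mul_assoc, Matrix.mul_adjugate, Matrix.smul_mul,
      Matrix.one_mul]
  exact ⟨Matrix.of A', Matrix.ext fun i j => mul_left_cancel₀ hτ (congr_fun₂ hsmul i j)⟩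

/-- **Corollary 1.5.** Let `A ∈ ℤ^{d×n}` be a unimodular matrix of rank `d`
(all nonzero maximal minors have the same absolute value, and some maximal minor is
nonzero).  Then there exist a nonsingular integer matrix `B ∈ ℤ^{d×d}` and an integer
matrix `A' ∈ ℤ^{d×n}` with `A = B·A'` such that `A'` is unimodular of rank `d`
with `δ(A') = 1`. -/
theorem exists_factorization_unimodular_delta_one (d n : ℕ)
    (A : Matrix (Fin d) (Fin n) ℤ) (hrank : A.rank = d) (δ : ℕ)
    (hδ : ∀ σ : Fin d → Fin n,
      (A.submatrix id σ).det ≠ 0 → (A.submatrix id σ).det.natAbs = δ)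
    (hex : ∃ σ : Fin d → Fin n, (A.submatrix id σ).det ≠ 0) :
    ∃ (B : Matrix (Fin d) (Fin d) ℤ) (A' : Matrix (Fin d) (Fin n) ℤ),
      B.det ≠ 0 ∧ A = B * A' ∧ A'.rank = d ∧
      (∀ σ : Fin d → Fin n,
        (A'.submatrix id σ).det ≠ 0 → (A'.submatrix id σ).det.natAbs = 1) ∧
      (∃ σ : Fin d → Fin n, (A'.submatrix id σ).det ≠ 0) := by
  obtain ⟨τ, hτ⟩ := hex
  obtain ⟨A', hA'⟩ := exists_eq_submatrix_mul A τ hτ fun σ => by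
    by_cases hσ : (A.submatrix id σ).det = 0
    · simp [hσ]
    · rw [← Int.natAbs_dvd_natAbs, hδ σ hσ, hδ τ hτ]
  have hdet (σ : Fin d → Fin n) :
      (A.submatrix id σ).det = (A.submatrix id τ).det * (A'.submatrix id σ).det := by
    rw [← Matrix.det_mul]
    conv_lhs => rw [hA']
    rfl
  refine ⟨A.submatrix id τ, A', hτ, hA', ?_, fun σ hσ => ?_, τ, fun h => hτ ?_⟩
  · refine le_antisymm (by simpa using A'.rank_le_card_height) ?_
    have h := Matrix.rank_mul_le_right (A.submatrix id τ) A'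
    rwa [← hA', hrank] at h
  · have hne : (A.submatrix id σ).det ≠ 0 := by
      rw [hdet σ]
      exact mul_ne_zero hτ hσ
    have h := hδ σ hne
    rw [hdet σ, Int.natAbs_mul, ← hδ τ hτ] at h
    exact (Nat.mul_eq_left (Int.natAbs_ne_zero.mpr hτ)).mp h
  · rw [hdet τ, h, mul_zero]
end

section
/- Let A ∈ ℤ^{d×n} be a configuration. If the normality condition ℤ_{≥0}A^± = ℤA^± ∩ ℚ_{≥0}A^± holds for the centrally symmetric configuration A^±, then the normality condition ℤ_{≥0}A = ℤA ∩ ℚ_{≥0}A holds for A. -/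
/-- The subgroup `ℤA` of `ℤ^d` generated by the columns of an integer matrix. -/
def colLattice {d n : ℕ} (A : Matrix (Fin d) (Fin n) ℤ) : AddSubgroup (Fin d → ℤ) :=
  AddSubgroup.closure (Set.range fun j i => A i j)

/-- The submonoid `ℤ_{≥0}A` of `ℤ^d` generated by the columns of an integer matrix. -/
def colMonoid {d n : ℕ} (A : Matrix (Fin d) (Fin n) ℤ) : AddSubmonoid (Fin d → ℤ) :=
  AddSubmonoid.closure (Set.range fun j i => A i j)

/-- The set `ℚ_{≥0}A` of lattice points that are nonnegative rational combinations of
the columns of `A`. -/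
def colQNonneg {d n : ℕ} (A : Matrix (Fin d) (Fin n) ℤ) : Set (Fin d → ℤ) :=
  {x | ∃ r : Fin n → ℚ, (∀ j, 0 ≤ r j) ∧ ∀ i, (x i : ℚ) = ∑ j, r j * (A i j : ℚ)}

/-- The normality condition `ℤ_{≥0}A = ℤA ∩ ℚ_{≥0}A` for the toric ring `K[A]`. -/
def IsNormalConfig {d n : ℕ} (A : Matrix (Fin d) (Fin n) ℤ) : Prop :=
  (colMonoid A : Set (Fin d → ℤ)) = (colLattice A : Set (Fin d → ℤ)) ∩ colQNonneg A

/-- The centrally symmetric configuration `A^± ∈ ℤ^{(d+1)×(2n+1)}` of `A ∈ ℤ^{d×n}`: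
its columns are `(0,…,0,1)ᵀ` (column `0`), `(a_j, 1)ᵀ` (columns `1,…,n`) and
`(−a_j, 1)ᵀ` (columns `n+1,…,2n`). -/
def csc {d n : ℕ} (A : Matrix (Fin d) (Fin n) ℤ) :
    Matrix (Fin (d + 1)) (Fin (2 * n + 1)) ℤ := fun i j =>
  if hi : (i : ℕ) < d then
    if h0 : (j : ℕ) = 0 then 0
    else if hj : (j : ℕ) ≤ n then A ⟨i, hi⟩ ⟨(j : ℕ) - 1, by omega⟩
    else - A ⟨i, hi⟩ ⟨(j : ℕ) - n - 1, by have := j.isLt; omega⟩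
  else 1

theorem colMonoid_subset_colLattice {d n : ℕ} (A : Matrix (Fin d) (Fin n) ℤ) :
    (colMonoid A : Set (Fin d → ℤ)) ⊆ colLattice A :=
  (AddSubmonoid.closure_le (S := (colLattice A).toAddSubmonoid)).2 AddSubgroup.subset_closure

theorem colMonoid_subset_colQNonneg {d n : ℕ} (A : Matrix (Fin d) (Fin n) ℤ) :
    (colMonoid A : Set (Fin d → ℤ)) ⊆ colQNonneg A := by
  intro x hx
  induction hx using AddSubmonoid.closure_induction with
  | mem x hx =>
    obtain ⟨j, rfl⟩ := hx
    refine ⟨Pi.single j 1, fun k => ?_, fun i => ?_⟩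
    · by_cases h : k = j <;> simp [h]
    · simp [Pi.single_apply]
  | zero => exact ⟨0, by simp, by simp⟩
  | add x y _ _ hx hy =>
    obtain ⟨r, hr, hxr⟩ := hx
    obtain ⟨s, hs, hys⟩ := hy
    refine ⟨r + s, fun j => add_nonneg (hr j) (hs j), fun i => ?_⟩
    simp [hxr, hys, add_mul, Finset.sum_add_distrib]

/-- The index in `csc A` of the column `(a_j, 1)ᵀ`. -/
def cscPosIndex {n : ℕ} (j : Fin n) : Fin (2 * n + 1) := ⟨j + 1, by omega⟩

theorem cscPosIndex_injective {n : ℕ} : Function.Injective (cscPosIndex (n := n)) := by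
  intro j k h
  simpa [cscPosIndex, Fin.ext_iff] using h

theorem csc_last {d n : ℕ} (A : Matrix (Fin d) (Fin n) ℤ) (k : Fin (2 * n + 1)) :
    csc A (Fin.last d) k = 1 := by
  simp [csc]

theorem csc_castSucc_cscPosIndex {d n : ℕ} (A : Matrix (Fin d) (Fin n) ℤ) (i : Fin d)
    (j : Fin n) : csc A i.castSucc (cscPosIndex j) = A i j := by
  have : (j : ℕ) + 1 ≤ n := j.isLt
  simp [csc, cscPosIndex]

/-- Every column of `csc A` is the apex, a column `(a_j, 1)ᵀ` or a column `(-a_j, 1)ᵀ`. -/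
theorem csc_column_cases {d n : ℕ} (A : Matrix (Fin d) (Fin n) ℤ) (k : Fin (2 * n + 1)) :
    (∀ i : Fin d, csc A i.castSucc k = 0) ∨
      ∃ j, (∀ i : Fin d, csc A i.castSucc k = A i j) ∨
        ∀ i : Fin d, csc A i.castSucc k = -A i j := by
  by_cases h0 : (k : ℕ) = 0
  · exact Or.inl fun i => by simp [csc, h0]
  right
  by_cases hk : (k : ℕ) ≤ n
  · exact ⟨⟨k - 1, by omega⟩, Or.inl fun i => by simp only [csc]; simp [h0, hk]⟩
  · have := k.isLt
    exact ⟨⟨k - n - 1, by omega⟩, Or.inr fun i => by simp only [csc]; simp [h0, hk]⟩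

theorem snoc_mem_colQNonneg_csc {d n : ℕ} (A : Matrix (Fin d) (Fin n) ℤ) (x : Fin d → ℤ)
    (s : ℤ) (r : Fin n → ℚ) (hr : ∀ j, 0 ≤ r j)
    (hx : ∀ i, (x i : ℚ) = ∑ j, r j * (A i j : ℚ)) (hs : (s : ℚ) = ∑ j, r j) :
    (Fin.snoc x s : Fin (d + 1) → ℤ) ∈ colQNonneg (csc A) := by
  have hsum (f : Fin (2 * n + 1) → ℚ) :
      ∑ k, Function.extend cscPosIndex r 0 k * f k = ∑ j, r j * f (cscPosIndex j) := by
    refine (Finset.sum_of_injOn cscPosIndex cscPosIndex_injective.injOn (by simp) ?_ ?_).symm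
    · intro k _ hk
      rw [Function.extend_apply' _ _ _ (by simpa using hk)]
      simp
    · intro j _
      rw [cscPosIndex_injective.extend_apply]
  refine ⟨Function.extend cscPosIndex r 0, fun k => ?_, fun i => ?_⟩
  · by_cases hk : ∃ j, cscPosIndex j = k
    · obtain ⟨j, rfl⟩ := hk
      simpa [cscPosIndex_injective.extend_apply] using hr j
    · simp [Function.extend_apply' _ _ _ hk]
  · rw [hsum]
    refine Fin.lastCases ?_ (fun i => ?_) i
    · simp [csc_last, hs]
    · simp [csc_castSucc_cscPosIndex, hx]

theorem exists_snoc_mem_colLattice_csc {d n : ℕ} (A : Matrix (Fin d) (Fin n) ℤ)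
    (c : Fin d → ℚ) (hc : ∀ j, ∑ i, c i * (A i j : ℚ) = 1) {x : Fin d → ℤ}
    (hx : x ∈ colLattice A) :
    ∃ s : ℤ, ∑ i, c i * (x i : ℚ) = s ∧
      (Fin.snoc x s : Fin (d + 1) → ℤ) ∈ colLattice (csc A) := by
  induction hx using AddSubgroup.closure_induction with
  | mem x hx =>
    obtain ⟨j, rfl⟩ := hx
    refine ⟨1, by simpa using hc j, AddSubgroup.subset_closure ⟨cscPosIndex j, ?_⟩⟩
    ext i
    refine Fin.lastCases ?_ (fun i => ?_) i
    · simp [csc_last]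
    · simp [csc_castSucc_cscPosIndex]
  | zero =>
    refine ⟨0, by simp, ?_⟩
    convert (colLattice (csc A)).zero_mem using 1
    ext i
    refine Fin.lastCases ?_ (fun i => ?_) i <;> simp
  | add x y _ _ hx hy =>
    obtain ⟨s, hs, hxs⟩ := hx
    obtain ⟨t, ht, hyt⟩ := hy
    refine ⟨s + t, by simp [mul_add, Finset.sum_add_distrib, hs, ht], ?_⟩
    convert (colLattice (csc A)).add_mem hxs hyt using 1
    ext i
    refine Fin.lastCases ?_ (fun i => ?_) i <;> simp
  | neg x _ hx =>
    obtain ⟨s, hs, hxs⟩ := hx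
    refine ⟨-s, by simp [hs], ?_⟩
    convert (colLattice (csc A)).neg_mem hxs using 1
    ext i
    refine Fin.lastCases ?_ (fun i => ?_) i <;> simp

/-- The height of a point of `ℤ_{≥0}A^±` bounds the value of the functional `c` on its
projection, and equality forces the projection into `ℤ_{≥0}A`. -/
theorem sum_init_le_last_of_mem_colMonoid_csc {d n : ℕ} (A : Matrix (Fin d) (Fin n) ℤ)
    (c : Fin d → ℚ) (hc : ∀ j, ∑ i, c i * (A i j : ℚ) = 1) {y : Fin (d + 1) → ℤ}
    (hy : y ∈ colMonoid (csc A)) :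
    ∑ i : Fin d, c i * (y i.castSucc : ℚ) ≤ y (Fin.last d) ∧
      (∑ i : Fin d, c i * (y i.castSucc : ℚ) = y (Fin.last d) →
        (fun i : Fin d => y i.castSucc) ∈ colMonoid A) := by
  induction hy using AddSubmonoid.closure_induction with
  | mem y hy =>
    obtain ⟨k, rfl⟩ := hy
    rcases csc_column_cases A k with h | ⟨j, h | h⟩
    · simp [h, csc_last]
    · simp only [h, csc_last, hc]
      exact ⟨by simp, fun _ => AddSubmonoid.subset_closure ⟨j, rfl⟩⟩
    · simp only [h, csc_last, Int.cast_neg, mul_neg, Finset.sum_neg_distrib, hc]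
      norm_num
  | zero => exact ⟨by simp, fun _ => (colMonoid A).zero_mem⟩
  | add x y _ _ hx hy =>
    simp only [Pi.add_apply, Int.cast_add, mul_add, Finset.sum_add_distrib]
    refine ⟨add_le_add hx.1 hy.1, fun h => (colMonoid A).add_mem (hx.2 ?_) (hy.2 ?_)⟩
    · linarith [hx.1, hy.1]
    · linarith [hx.1, hy.1]

/-- **Corollary 2.5.** Let `A ∈ ℤ^{d×n}` be a configuration.  If the normality
condition holds for the centrally symmetric configuration `A^±`, then it holds
for `A`; i.e. if `K[A^±]` is normal, then `K[A]` is normal. -/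
theorem normal_of_csc_normal (d n : ℕ)
    (A : Matrix (Fin d) (Fin n) ℤ)
    (hconf : ∃ c : Fin d → ℚ, ∀ j : Fin n, ∑ i, c i * (A i j : ℚ) = 1)
    (hpm : IsNormalConfig (csc A)) :
    IsNormalConfig A := by
  obtain ⟨c, hc⟩ := hconf
  refine Set.Subset.antisymm
    (Set.subset_inter (colMonoid_subset_colLattice A) (colMonoid_subset_colQNonneg A)) ?_
  rintro x ⟨hxL, r, hr, hx⟩
  obtain ⟨s, hs, hxs⟩ := exists_snoc_mem_colLattice_csc A c hc hxL
  have hsr : (s : ℚ) = ∑ j, r j := by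
    calc (s : ℚ) = ∑ i, ∑ j, c i * (r j * (A i j : ℚ)) := by
          simp only [← hs, hx, Finset.mul_sum]
      _ = ∑ j, r j * ∑ i, c i * (A i j : ℚ) := by
          rw [Finset.sum_comm]
          simp only [Finset.mul_sum, mul_left_comm]
      _ = ∑ j, r j := by simp [hc]
  have hmem : (Fin.snoc x s : Fin (d + 1) → ℤ) ∈ colMonoid (csc A) :=
    hpm.superset ⟨hxs, snoc_mem_colQNonneg_csc A x s r hr hx hsr⟩
  simpa using (sum_init_le_last_of_mem_colMonoid_csc A c hc hmem).2 (by simpa using hs)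
end

section
/- Let A ∈ ℤ^{d×n} be a unimodular matrix of rank d with δ(A) = 1 and columns a_1,…,a_n, and let P ⊆ ℝ^d be the convex hull of {0} ∪ {a_1,…,a_n} ∪ {−a_1,…,−a_n}. Then P is a Gorenstein Fano polytope: P is d-dimensional, the origin is the unique lattice point of ℤ^d lying in the interior of P, and the dual polytope P* = { x ∈ ℝ^d : ⟨x,y⟩ ≤ 1 for all y ∈ P } is integral, i.e. P* equals the convex hull of P* ∩ ℤ^d. -/
/-- If the columns of an integer matrix of full row rank are all orthogonal to a real vector `w`,
then `w = 0`. -/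
lemma Matrix.eq_zero_of_orthogonal_cols_of_rank_eq {d n : ℕ} {A : Matrix (Fin d) (Fin n) ℤ}
    (hrank : A.rank = d) {w : Fin d → ℝ} (hw : ∀ j, ∑ i, w i * (A i j : ℝ) = 0) : w = 0 := by
  have hfin : Finite ((Fin d → ℤ) ⧸ LinearMap.range A.mulVecLin) := by
    apply Submodule.finiteQuotientOfFreeOfRankEq
    rw [Module.finrank_fin_fun]
    exact hrank
  set N := Nat.card ((Fin d → ℤ) ⧸ LinearMap.range A.mulVecLin) with hN
  have hN0 : N ≠ 0 := Nat.card_pos.ne'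
  ext k
  have hmem : N • (Pi.single k 1 : Fin d → ℤ) ∈ LinearMap.range A.mulVecLin := by
    rw [← Submodule.Quotient.mk_eq_zero, Submodule.Quotient.mk_smul]
    exact card_nsmul_eq_zero'
  obtain ⟨c, hc⟩ := hmem
  have hsum : ∑ i, w i * ((∑ j, A i j * c j : ℤ) : ℝ) = 0 := by
    push_cast
    simp_rw [Finset.mul_sum]
    rw [Finset.sum_comm]
    refine Finset.sum_eq_zero fun j _ => ?_
    simp_rw [← mul_assoc]
    rw [← Finset.sum_mul, hw, zero_mul]
  have hci : ∀ i, ∑ j, A i j * c j = N • (Pi.single k 1 : Fin d → ℤ) i := fun i => congrFun hc i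
  simp_rw [hci] at hsum
  simpa [Pi.single_apply, hN0] using hsum

/-- A family of vectors in `ℝ^d` whose orthogonal complement is trivial spans. -/
lemma span_range_eq_top_of_orthogonal {ι : Type*} {d : ℕ} (v : ι → Fin d → ℝ)
    (h : ∀ w : Fin d → ℝ, (∀ j, ∑ i, w i * v j i = 0) → w = 0) :
    Submodule.span ℝ (Set.range v) = ⊤ := by
  by_contra hne
  obtain ⟨f, hf0, hf⟩ := Submodule.exists_le_ker_of_lt_top _ (lt_top_iff_ne_top.2 hne)
  have hfe : ∀ y, f y = ∑ i, f (Pi.single i 1) * y i := fun y => by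
    conv_lhs => rw [← Finset.univ_sum_single y]
    rw [map_sum]
    refine Finset.sum_congr rfl fun i _ => ?_
    rw [mul_comm, ← smul_eq_mul, ← map_smul, ← Pi.single_smul]
    simp
  have hw := h (fun i => f (Pi.single i 1)) fun j => by
    rw [← hfe]
    exact hf (Submodule.subset_span ⟨j, rfl⟩)
  apply hf0
  refine LinearMap.ext fun y => ?_
  rw [hfe]
  exact Finset.sum_eq_zero fun i _ => by
    rw [show f (Pi.single i 1) = 0 from congrFun hw i, zero_mul]

/-- A spanning family of vectors in `ℝ^d` contains a nonsingular `d × d` submatrix. -/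
lemma exists_det_ne_zero_of_span_eq_top {ι : Type*} {d : ℕ} (v : ι → Fin d → ℝ)
    (h : Submodule.span ℝ (Set.range v) = ⊤) :
    ∃ σ : Fin d → ι, (Matrix.of fun i k => v (σ i) k).det ≠ 0 := by
  obtain ⟨κ, a, -, hspan, hli⟩ := exists_linearIndependent' ℝ v
  let b := Module.Basis.mk hli (by rw [hspan, h])
  have : Finite κ := Module.Finite.finite_basis b
  have : Fintype κ := Fintype.ofFinite κ
  have hcard : Fintype.card κ = d := by
    rw [← Module.finrank_eq_card_basis b, Module.finrank_fin_fun]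
  let e := Fintype.equivFinOfCardEq hcard
  refine ⟨a ∘ e.symm, ?_⟩
  have hli' : LinearIndependent ℝ (Matrix.of fun i k => v ((a ∘ e.symm) i) k).row :=
    hli.comp _ e.symm.injective
  rw [Matrix.linearIndependent_rows_iff_isUnit, Matrix.isUnit_iff_isUnit_det] at hli'
  exact hli'.ne_zero

/-- A real solution of a linear system with unimodular integer matrix and integer right-hand side
is integral. -/
lemma Matrix.exists_int_eq_of_isUnit_det {d : ℕ} {B : Matrix (Fin d) (Fin d) ℤ}
    (hB : IsUnit B.det) {x : Fin d → ℝ} {z : Fin d → ℤ}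
    (h : ∀ i, ∑ k, (B i k : ℝ) * x k = z i) (i : Fin d) : ∃ m : ℤ, (m : ℝ) = x i := by
  have hx : (B.map (Int.cast : ℤ → ℝ)).mulVec x = fun i => (z i : ℝ) := funext h
  have hinv : (B⁻¹).map (Int.cast : ℤ → ℝ) * B.map (Int.cast : ℤ → ℝ) = 1 := by
    have := congrArg (fun M => M.map (Int.castRingHom ℝ)) (B.nonsing_inv_mul hB)
    rw [Matrix.map_mul] at this
    simpa using this
  refine ⟨(B⁻¹).mulVec z i, ?_⟩
  have := congrArg (((B⁻¹).map (Int.cast : ℤ → ℝ)).mulVec) hx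
  rw [Matrix.mulVec_mulVec, hinv, Matrix.one_mulVec] at this
  rw [this]
  simp [Matrix.mulVec, dotProduct]

/-- The dual of the convex hull of `0` and the vectors `±v j` is cut out by the inequalities
`|⟨x, v j⟩| ≤ 1`. -/
lemma mem_dual_convexHull_symm_iff {ι : Type*} {d : ℕ} (v : ι → Fin d → ℝ) (x : Fin d → ℝ) :
    (∀ y ∈ convexHull ℝ ({0} ∪ Set.range v ∪ (Neg.neg '' Set.range v)), ∑ i, x i * y i ≤ 1) ↔
      ∀ j, |∑ i, x i * v j i| ≤ 1 := by
  constructor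
  · intro h j
    rw [abs_le']
    refine ⟨h _ (subset_convexHull ℝ _ (Or.inl (Or.inr ⟨j, rfl⟩))), ?_⟩
    have := h _ (subset_convexHull ℝ _ (Or.inr ⟨_, ⟨j, rfl⟩, rfl⟩))
    simpa using this
  · intro h
    have hconv : Convex ℝ {y : Fin d → ℝ | ∑ i, x i * y i ≤ 1} :=
      convex_halfSpace_le (f := fun y : Fin d → ℝ => ∑ i, x i * y i)
        ⟨fun y z => by simp [mul_add, Finset.sum_add_distrib],
          fun c y => by simp [Finset.mul_sum, mul_left_comm]⟩ 1
    refine fun y hy => convexHull_min ?_ hconv hy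
    rintro y ((rfl | ⟨j, rfl⟩) | ⟨_, ⟨j, rfl⟩, rfl⟩)
    · simp
    · exact (abs_le'.1 (h j)).1
    · simpa using (abs_le'.1 (h j)).2

/-- At an extreme point of `{x | ∀ j, |⟨x, v j⟩| ≤ 1}`, a vector orthogonal to every tight
constraint is zero. -/
lemma eq_zero_of_mem_extremePoints {ι : Type*} [Finite ι] {d : ℕ} (v : ι → Fin d → ℝ)
    {x : Fin d → ℝ}
    (hx : x ∈ Set.extremePoints ℝ {x : Fin d → ℝ | ∀ j, |∑ i, x i * v j i| ≤ 1})
    {w : Fin d → ℝ} (hw : ∀ j, |∑ i, x i * v j i| = 1 → ∑ i, w i * v j i = 0) : w = 0 := by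
  have hev : ∀ᶠ t : ℝ in nhds 0, ∀ j, |∑ i, (x + t • w) i * v j i| ≤ 1 := by
    rw [Filter.eventually_all]
    intro j
    by_cases hj : |∑ i, x i * v j i| = 1
    · refine Filter.Eventually.of_forall fun t => ?_
      simp [add_mul, Finset.sum_add_distrib, mul_assoc, ← Finset.mul_sum, hw j hj, hj]
    · have hlt := lt_of_le_of_ne (hx.1 j) hj
      have hc : Continuous fun t : ℝ => |∑ i, (x + t • w) i * v j i| := by
        simp only [Pi.add_apply, Pi.smul_apply]
        fun_prop
      refine (hc.tendsto 0).eventually_le_const ?_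
      simpa using hlt
  have hneg : ∀ᶠ t : ℝ in nhds 0, ∀ j, |∑ i, (x + (-t) • w) i * v j i| ≤ 1 := by
    have : Filter.Tendsto (fun t : ℝ => -t) (nhds 0) (nhds 0) := by
      simpa using (continuous_neg.tendsto (0 : ℝ))
    exact this.eventually hev
  obtain ⟨t, ⟨h1, h2⟩, ht⟩ := ((hev.and hneg).filter_mono nhdsWithin_le_nhds |>.and
    (self_mem_nhdsWithin : Set.Ioi (0 : ℝ) ∈ nhdsWithin 0 (Set.Ioi 0))).exists
  have hseg : x ∈ openSegment ℝ (x + t • w) (x + (-t) • w) :=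
    ⟨1 / 2, 1 / 2, by norm_num, by norm_num, by norm_num, by module⟩
  have heq : x + t • w = x := hx.2 h1 h2 hseg
  have : t • w = 0 := by simpa using heq
  exact (smul_eq_zero.1 this).resolve_left (ne_of_gt ht)


/-- **Lemma 2.9.** Let `A ∈ ℤ^{d×n}` be a unimodular matrix of rank `d` with
`δ(A) = 1` (every nonzero maximal minor has absolute value `1`), and let
`P ⊆ ℝ^d` be the convex hull of `{0} ∪ {a_1,…,a_n} ∪ {−a_1,…,−a_n}` (the standard
form of `Conv(A^±)`).  Then `P` is a Gorenstein Fano polytope: `P` has dimension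
`d`, the origin is the unique lattice point in the interior of `P`, and the dual
polytope `P* = {x : ⟨x,y⟩ ≤ 1 for all y ∈ P}` is integral, i.e. `P*` is the convex
hull of its lattice points. -/
theorem csc_standard_form_gorenstein_fano (d n : ℕ)
    (A : Matrix (Fin d) (Fin n) ℤ) (hrank : A.rank = d)
    (hδ : ∀ σ : Fin d → Fin n,
      (A.submatrix id σ).det ≠ 0 → (A.submatrix id σ).det.natAbs = 1)
    (P : Set (Fin d → ℝ))
    (hP : P = convexHull ℝ
      ({0} ∪ (Set.range fun j (i : Fin d) => ((A i j : ℤ) : ℝ)) ∪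
        (Neg.neg '' Set.range fun j (i : Fin d) => ((A i j : ℤ) : ℝ)))) :
    Module.finrank ℝ (affineSpan ℝ P).direction = d ∧
    {x : Fin d → ℤ | (fun i => (x i : ℝ)) ∈ interior P} = {0} ∧
    {x : Fin d → ℝ | ∀ y ∈ P, ∑ i, x i * y i ≤ 1} =
      convexHull ℝ {x : Fin d → ℝ |
        (∀ y ∈ P, ∑ i, x i * y i ≤ 1) ∧ ∀ i, ∃ z : ℤ, (z : ℝ) = x i} := by
  set v : Fin n → Fin d → ℝ := fun j i => ((A i j : ℤ) : ℝ) with hv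
  have horth : ∀ w : Fin d → ℝ, (∀ j, ∑ i, w i * v j i = 0) → w = 0 := fun w hw =>
    Matrix.eq_zero_of_orthogonal_cols_of_rank_eq hrank hw
  have hdual : ∀ x : Fin d → ℝ, (∀ y ∈ P, ∑ i, x i * y i ≤ 1) ↔
      ∀ j, |∑ i, x i * v j i| ≤ 1 := fun x => hP ▸ mem_dual_convexHull_symm_iff v x
  have hPconv : Convex ℝ P := hP ▸ convex_convexHull ℝ _
  have h0P : (0 : Fin d → ℝ) ∈ P := hP ▸ subset_convexHull ℝ _ (Or.inl (Or.inl rfl))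
  have hvP : ∀ j, v j ∈ P := fun j => hP ▸ subset_convexHull ℝ _ (Or.inl (Or.inr ⟨j, rfl⟩))
  have hPneg : -P = P := by
    rw [hP, ← convexHull_neg]
    congr 1
    ext y
    simp only [Set.mem_neg, Set.mem_union, Set.mem_singleton_iff, Set.mem_image, exists_eq_right,
      neg_eq_iff_eq_neg, neg_zero, neg_neg]
    tauto
  have hdir : (affineSpan ℝ P).direction = ⊤ := by
    rw [eq_top_iff, ← span_range_eq_top_of_orthogonal v horth, Submodule.span_le]
    rintro _ ⟨j, rfl⟩
    have := AffineSubspace.vsub_mem_direction (subset_affineSpan ℝ P (hvP j))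
      (subset_affineSpan ℝ P h0P)
    simpa using this
  have hspan : affineSpan ℝ P = ⊤ :=
    (AffineSubspace.direction_eq_top_iff_of_nonempty ⟨0, subset_affineSpan ℝ P h0P⟩).1 hdir
  have h0int : (0 : Fin d → ℝ) ∈ interior P := by
    obtain ⟨x, hx⟩ := (hPconv.interior_nonempty_iff_affineSpan_eq_top).2 hspan
    have hx' : -x ∈ interior P := by
      have h : -interior P = interior (-P) := (Homeomorph.neg (Fin d → ℝ)).preimage_interior P
      rw [hPneg] at h
      rwa [← h, Set.neg_mem_neg]
    have := hPconv.interior hx hx' (by norm_num : (0 : ℝ) ≤ 1 / 2)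
      (by norm_num : (0 : ℝ) ≤ 1 / 2) (by norm_num)
    simpa using this
  set Q : Set (Fin d → ℝ) := {x | ∀ y ∈ P, ∑ i, x i * y i ≤ 1} with hQ
  set L : Set (Fin d → ℝ) :=
    {x | (∀ y ∈ P, ∑ i, x i * y i ≤ 1) ∧ ∀ i, ∃ z : ℤ, (z : ℝ) = x i} with hL
  have hQeq : Q = {x | ∀ j, |∑ i, x i * v j i| ≤ 1} := Set.ext hdual
  have hQconv : Convex ℝ Q := by
    rw [hQ, Set.ofPred_forall]
    refine convex_iInter fun y => ?_
    rw [Set.ofPred_forall]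
    exact convex_iInter fun _ => convex_halfSpace_le (f := fun x : Fin d → ℝ => ∑ i, x i * y i)
      ⟨fun a b => by simp [add_mul, Finset.sum_add_distrib],
        fun c a => by simp [Finset.mul_sum, mul_assoc]⟩ 1
  have hQclosed : IsClosed Q := by
    rw [hQ, Set.ofPred_forall]
    refine isClosed_iInter fun y => ?_
    rw [Set.ofPred_forall]
    exact isClosed_iInter fun _ => isClosed_le (by fun_prop) (by fun_prop)
  obtain ⟨r, hr, hball⟩ :=
    Metric.nhds_basis_closedBall.mem_iff.1 (mem_interior_iff_mem_nhds.1 h0int)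
  have hQbound : ∀ x ∈ Q, ∀ i, |x i| ≤ 1 / r := by
    intro x hx i
    have key : ∀ s : ℝ, |s| = r → x i * s ≤ 1 := by
      intro s hs
      have hs' : ‖(Pi.single i s : Fin d → ℝ)‖ ≤ r := by
        rw [pi_norm_le_iff_of_nonneg hr.le]
        intro k
        by_cases hk : k = i <;> simp [hk, hs, hr.le]
      have := hx (Pi.single i s) (hball (mem_closedBall_zero_iff.2 hs'))
      simpa [Pi.single_apply] using this
    have h1 := key r (abs_of_pos hr)
    have h2 := key (-r) (by rw [abs_neg, abs_of_pos hr])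
    rw [le_div_iff₀ hr]
    rcases abs_cases (x i) with ⟨h, -⟩ | ⟨h, -⟩ <;> rw [h] <;> linarith
  have hQcpt : IsCompact Q := by
    refine (isCompact_univ_pi fun _ : Fin d =>
      isCompact_Icc (a := -(1 / r)) (b := 1 / r)).of_isClosed_subset hQclosed fun x hx i _ => abs_le.1 (hQbound x hx i)
  have hLfin : L.Finite := by
    refine (Set.Finite.pi' fun _ : Fin d =>
      (Set.finite_Icc (-⌈1 / r⌉) ⌈1 / r⌉).image (Int.cast : ℤ → ℝ)).subset ?_
    rintro x ⟨hx, hz⟩ i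
    obtain ⟨z, hz⟩ := hz i
    have hb := hQbound x hx i
    rw [← hz] at hb
    have hb' : ((|z| : ℤ) : ℝ) ≤ (⌈1 / r⌉ : ℤ) := by
      push_cast
      exact hb.trans (Int.le_ceil _)
    exact ⟨z, abs_le.1 (Int.cast_le.1 hb'), hz⟩
  have hext : Q.extremePoints ℝ ⊆ L := by
    intro x hx
    refine ⟨hx.1, ?_⟩
    rw [hQeq] at hx
    obtain ⟨σ, hσ⟩ := exists_det_ne_zero_of_span_eq_top
      (fun j : {j // |∑ i, x i * v j i| = 1} => v j)
      (span_range_eq_top_of_orthogonal _ fun w hw =>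
        eq_zero_of_mem_extremePoints v hx fun j hj => hw ⟨j, hj⟩)
    set B := (A.submatrix id fun i => (σ i : Fin n)).transpose with hB
    have hdet : B.det ≠ 0 := by
      intro h
      apply hσ
      have := congrArg (Int.castRingHom ℝ) h
      rwa [RingHom.map_det, map_zero] at this
    have hunit : IsUnit B.det := by
      rw [hB, Matrix.det_transpose] at hdet ⊢
      exact Int.isUnit_iff_natAbs_eq.2 (hδ _ hdet)
    have hz : ∀ i, ∃ z : ℤ, ∑ k, (B i k : ℝ) * x k = z := by
      intro i
      have h1 : ∑ k, (B i k : ℝ) * x k = ∑ k, x k * v (σ i) k :=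
        Finset.sum_congr rfl fun k _ => mul_comm _ _
      rw [h1]
      rcases eq_or_eq_neg_of_abs_eq (σ i).2 with h | h
      · exact ⟨1, by simpa using h⟩
      · exact ⟨-1, by simpa using h⟩
    choose z hz using hz
    exact Matrix.exists_int_eq_of_isUnit_det hunit hz
  have hQL : Q = convexHull ℝ L := by
    refine Set.Subset.antisymm ?_ (convexHull_min (fun x hx => hx.1) hQconv)
    rw [← closure_convexHull_extremePoints hQcpt hQconv]
    exact closure_minimal (convexHull_mono hext)
      (hLfin.isCompact_convexHull ℝ).isClosed
  refine ⟨by rw [hdir, finrank_top, Module.finrank_fin_fun], ?_, hQL⟩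
  refine Set.Subset.antisymm (fun x hx => ?_) ?_
  · set y : Fin d → ℝ := fun i => (x i : ℝ) with hy
    have hx : y ∈ interior P := hx
    obtain ⟨t, htP, ht⟩ : ∃ t : ℝ, t • y ∈ P ∧ 1 < t := by
      have hc : ContinuousAt (fun t : ℝ => t • y) 1 := by fun_prop
      have hev : ∀ᶠ t : ℝ in nhds 1, t • y ∈ P :=
        hc.eventually (by simpa using mem_interior_iff_mem_nhds.1 hx)
      exact (hev.filter_mono nhdsWithin_le_nhds |>.and
        (self_mem_nhdsWithin : Set.Ioi (1 : ℝ) ∈ nhdsWithin 1 (Set.Ioi 1))).exists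
    have hLle : L ⊆ {u | ∑ i, u i * y i ≤ 0} := by
      rintro u ⟨hu, huz⟩
      choose z hz using huz
      have h1 : t * ∑ i, u i * y i ≤ 1 := by
        have := hu _ htP
        simpa [Finset.mul_sum, mul_left_comm] using this
      have h2 : ∑ i, u i * y i = ((∑ i, z i * x i : ℤ) : ℝ) := by simp [hz, hy]
      simp only [Set.mem_ofPred_eq]
      rw [h2] at h1 ⊢
      by_contra! hpos
      have hpos' : (1 : ℝ) ≤ ((∑ i, z i * x i : ℤ) : ℝ) := by exact_mod_cast hpos
      nlinarith
    have hQle : Q ⊆ {u | ∑ i, u i * y i ≤ 0} := by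
      rw [hQL]
      exact convexHull_min hLle (convex_halfSpace_le (f := fun u : Fin d → ℝ => ∑ i, u i * y i)
        ⟨fun a b => by simp [add_mul, Finset.sum_add_distrib],
          fun c a => by simp [Finset.mul_sum, mul_assoc]⟩ 0)
    set c : ℝ := 1 + ∑ j, |∑ i, y i * v j i| with hc
    have hsum : ∀ j, |∑ i, y i * v j i| ≤ ∑ j, |∑ i, y i * v j i| := fun j =>
      Finset.single_le_sum (f := fun j => |∑ i, y i * v j i|) (fun _ _ => abs_nonneg _)
        (Finset.mem_univ j)
    have hcpos : 0 < c := by positivity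
    have hcQ : c⁻¹ • y ∈ Q := by
      refine (hdual _).2 fun j => ?_
      have : ∑ i, (c⁻¹ • y) i * v j i = c⁻¹ * ∑ i, y i * v j i := by
        simp [Finset.mul_sum, mul_assoc]
      rw [this, abs_mul, abs_of_pos (inv_pos.2 hcpos), inv_mul_le_iff₀ hcpos]
      linarith [hsum j]
    have hle : c⁻¹ * ∑ i, y i * y i ≤ 0 := by
      have := hQle hcQ
      simpa [Finset.mul_sum, mul_assoc] using this
    have hyy : ∑ i, y i * y i ≤ 0 := nonpos_of_mul_nonpos_right hle (inv_pos.2 hcpos)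
    have hzero := (Finset.sum_eq_zero_iff_of_nonneg fun i _ => mul_self_nonneg (y i)).1
      (le_antisymm hyy (Finset.sum_nonneg fun i _ => mul_self_nonneg (y i)))
    ext i
    simpa [hy] using hzero i (Finset.mem_univ i)
  · rintro x rfl
    have h0 : (fun i => (((0 : Fin d → ℤ) i : ℤ) : ℝ)) = (0 : Fin d → ℝ) := by ext; simp
    rw [Set.mem_ofPred_eq, h0]
    exact h0int
end

section
/- Let A ∈ ℤ^{d×n} be a configuration with ℤA = ℤ^d for which the normality condition ℤ_{≥0}A = ℤA ∩ ℚ_{≥0}A holds. Then for every integer N ≥ 1 and every α ∈ ℤ^d whose image in ℝ^d lies in the dilated polytope N·Conv(A), there exist β_1,…,β_N ∈ ℤ^d, each lying in Conv(A), such that α = β_1 + ⋯ + β_N. -/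
open scoped Pointwise

/-- Rational-valued points in a convex hull of rational points have rational weights. -/
theorem exists_rat_weights_of_mem_convexHull {ι κ : Type*} [Finite κ] [Fintype ι]
    (v : ι → κ → ℚ) (x : κ → ℚ)
    (hx : (fun i => (x i : ℝ)) ∈ convexHull ℝ (Set.range fun j (i : κ) => (v j i : ℝ))) :
    ∃ r : ι → ℚ, (∀ j, 0 ≤ r j) ∧ ∑ j, r j = 1 ∧ ∀ i, x i = ∑ j, r j * v j i := by
  classical
  have := Fintype.ofFinite κ
  obtain ⟨φ, hφ⟩ := (Algebra.linearMap ℚ ℝ).exists_leftInverse_of_injective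
    (LinearMap.ker_eq_bot.2 (algebraMap ℚ ℝ).injective)
  have hφ' (q : ℚ) : φ (q : ℝ) = q := by simpa using LinearMap.congr_fun hφ q
  have hφmul (a : ℝ) (q : ℚ) : φ (a * q) = φ a * q := by
    rw [mul_comm a, ← Rat.smul_def, map_smul, smul_eq_mul, mul_comm]
  obtain ⟨τ, _, z, w, hz, hind, hw, hw1, hwx⟩ := eq_pos_convex_span_of_mem_convexHull hx
  choose f hf using fun t => hz (Set.mem_range_self t)
  have hwx' (i : κ) : ∑ t, w t * (v (f t) i : ℝ) = x i := by
    have := congrFun hwx i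
    simpa [← hf] using this
  have hsum : ∑ t, φ (w t) = 1 := by
    rw [← map_sum, hw1]
    simpa using hφ' 1
  have hφx (i : κ) : ∑ t, φ (w t) * v (f t) i = x i := by
    rw [← hφ' (x i), ← hwx' i, map_sum]
    simp [hφmul]
  -- affine independence makes the real weights agree with their rational images
  have hrat (t : τ) : w t = (φ (w t) : ℝ) := by
    have h0 := affineIndependent_iff.1 hind Finset.univ (fun t => w t - (φ (w t) : ℝ))
      (by rw [Finset.sum_sub_distrib, hw1, ← Rat.cast_sum, hsum]; simp)
      (by
        ext i
        have h1 : ∑ t, (φ (w t) : ℝ) * (v (f t) i : ℝ) = x i := by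
          rw [← hφx i]; push_cast; rfl
        simp [← hf, sub_mul, Finset.sum_sub_distrib, hwx', h1])
      t (Finset.mem_univ t)
    exact sub_eq_zero.1 h0
  refine ⟨fun j => ∑ t with f t = j, φ (w t), fun j => Finset.sum_nonneg fun t _ => ?_, ?_, ?_⟩
  · have := (hw t).le
    rw [hrat t] at this
    exact_mod_cast this
  · exact (Finset.sum_fiberwise _ f _).trans hsum
  · intro i
    rw [← hφx i, ← Finset.sum_fiberwise Finset.univ f]
    refine Finset.sum_congr rfl fun j _ => ?_
    rw [Finset.sum_mul]
    exact Finset.sum_congr rfl fun t ht => by rw [(Finset.mem_filter.1 ht).2]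

/-- A list of vectors on the hyperplane `⟨c, ·⟩ = 1` has length `⟨c, ·⟩` of its sum. -/
theorem sum_mul_list_sum_eq_length {κ : Type*} [Fintype κ] (c : κ → ℚ) (l : List (κ → ℤ))
    (hl : ∀ a ∈ l, ∑ i, c i * (a i : ℚ) = 1) :
    ∑ i, c i * (l.sum i : ℚ) = l.length := by
  induction l with
  | nil => simp
  | cons a l ih =>
    have ha := hl a (by simp)
    have := ih fun b hb => hl b (by simp [hb])
    simp [mul_add, Finset.sum_add_distrib, ha, this, add_comm]

/-- **Lemma 2.12.** Let `A ∈ ℤ^{d×n}` be a configuration with `ℤA = ℤ^d` whose toric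
ring is normal.  Then every lattice point `α` of the dilated polytope `N·Conv(A)` is
a sum `α = β_1 + ⋯ + β_N` of lattice points `β_1, …, β_N` of `Conv(A)`. -/
theorem lattice_point_of_dilation_decomposes (d n : ℕ)
    (A : Matrix (Fin d) (Fin n) ℤ)
    (hconf : ∃ c : Fin d → ℚ, ∀ j : Fin n, ∑ i, c i * (A i j : ℚ) = 1)
    (hgen : colLattice A = ⊤)
    (hnormal : IsNormalConfig A)
    (N : ℕ) (hN : 1 ≤ N) (α : Fin d → ℤ)
    (hα : (fun i => (α i : ℝ)) ∈
      (N : ℝ) • convexHull ℝ (Set.range fun j (i : Fin d) => ((A i j : ℤ) : ℝ))) :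
    ∃ β : Fin N → (Fin d → ℤ),
      (∀ k, (fun i => (β k i : ℝ)) ∈
        convexHull ℝ (Set.range fun j (i : Fin d) => ((A i j : ℤ) : ℝ))) ∧
      α = ∑ k, β k := by
  obtain ⟨c, hc⟩ := hconf
  have hN0 : (N : ℝ) ≠ 0 := by positivity
  have hN0' : (N : ℚ) ≠ 0 := by positivity
  obtain ⟨r, hr0, hr1, hr⟩ := exists_rat_weights_of_mem_convexHull
    (fun j i => (A i j : ℚ)) (fun i => (α i : ℚ) / N) (by
      obtain ⟨y, hy, hyα⟩ := hα
      have hxy : (fun i => (((α i : ℚ) / N : ℚ) : ℝ)) = y := by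
        ext i
        have : (N : ℝ) * y i = α i := congrFun hyα i
        push_cast
        rw [← this]
        field_simp
      rw [hxy]
      simpa using hy)
  have hα' (i : Fin d) : (α i : ℚ) = ∑ j, N * r j * (A i j : ℚ) := by
    have := hr i
    rw [div_eq_iff hN0'] at this
    rw [this, Finset.sum_mul]
    exact Finset.sum_congr rfl fun j _ => by ring
  have hmem : α ∈ (colMonoid A : Set (Fin d → ℤ)) := by
    rw [hnormal, hgen]
    exact ⟨trivial, fun j => N * r j, fun j => mul_nonneg (by positivity) (hr0 j), hα'⟩
  obtain ⟨l, hl, hlα⟩ := AddSubmonoid.exists_list_of_mem_closure hmem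
  have hlen : l.length = N := by
    have h1 := sum_mul_list_sum_eq_length c l fun a ha => by
      obtain ⟨j, rfl⟩ := hl a ha
      exact hc j
    have h2 : ∑ i, c i * (α i : ℚ) = N := by
      calc ∑ i, c i * (α i : ℚ) = ∑ j, N * r j * ∑ i, c i * (A i j : ℚ) := by
            simp only [hα', Finset.mul_sum]
            rw [Finset.sum_comm]
            exact Finset.sum_congr rfl fun j _ => Finset.sum_congr rfl fun i _ => by ring
        _ = N := by simp [hc, ← Finset.mul_sum, hr1]
    rw [hlα, h2] at h1
    exact_mod_cast h1.symm
  subst hlen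
  refine ⟨l.get, fun k => subset_convexHull ℝ _ ?_, ?_⟩
  · obtain ⟨j, hj⟩ := hl _ (l.get_mem k)
    exact ⟨j, by rw [← hj]⟩
  · rw [← hlα, ← List.sum_ofFn, List.ofFn_get]
end

section
/- Let G be a finite simple connected graph on the vertex set {1,…,d} with n edges. Then the normality condition ℤ_{≥0}(A_G)^± = ℤ(A_G)^± ∩ ℚ_{≥0}(A_G)^± holds (i.e. the toric ring K[(A_G)^±] is normal) if and only if any two odd cycles of G possess a common vertex, i.e. any two cycles of G of odd length share at least one vertex. -/
/-- The incidence matrix `A_G ∈ ℤ^{d×n}` of a graph with edges `{v k, w k}`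
(`v k < w k`): its `k`-th column is `ρ(e_k) = 𝐞_{v k} + 𝐞_{w k}`. -/
def edgeMatrix {d n : ℕ} (v w : Fin n → Fin d) : Matrix (Fin d) (Fin n) ℤ :=
  Matrix.of fun i k => (if i = v k then (1 : ℤ) else 0) + (if i = w k then 1 else 0)

namespace CentrallySymmetric

variable {d n : ℕ}

/-- The index of the column `(a_k, 1)` of `A^±`. -/
def posIdx (k : Fin n) : Fin (2 * n + 1) := ⟨k + 1, by omega⟩

/-- The index of the column `(-a_k, 1)` of `A^±`. -/
def negIdx (k : Fin n) : Fin (2 * n + 1) := ⟨n + k + 1, by omega⟩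

lemma eq_zero_or_posIdx_or_negIdx (j : Fin (2 * n + 1)) :
    j = 0 ∨ (∃ k, j = posIdx k) ∨ ∃ k, j = negIdx k := by
  obtain ⟨j, hj⟩ := j
  rcases Nat.eq_zero_or_pos j with h | h
  · left; ext; simpa using h
  · right
    by_cases hn : j ≤ n
    · left; refine ⟨⟨j - 1, by omega⟩, ?_⟩; ext; simp only [posIdx]; omega
    · right; refine ⟨⟨j - n - 1, by omega⟩, ?_⟩; ext; simp only [negIdx]; omega

lemma sum_index {M : Type*} [AddCommMonoid M] (f : Fin (2 * n + 1) → M) :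
    ∑ j, f j = f 0 + (∑ k : Fin n, f (posIdx k) + ∑ k : Fin n, f (negIdx k)) := by
  rw [Fin.sum_univ_succ]
  congr 1
  rw [← (finCongr (two_mul n).symm).sum_comp, Fin.sum_univ_add]
  rfl

section Columns

variable (A : Matrix (Fin d) (Fin n) ℤ)

@[simp] lemma csc_last (j : Fin (2 * n + 1)) : csc A (Fin.last d) j = 1 := by
  simp [csc]

@[simp] lemma csc_castSucc_zero (i : Fin d) : csc A i.castSucc 0 = 0 := by
  simp [csc]

@[simp] lemma csc_castSucc_posIdx (i : Fin d) (k : Fin n) :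
    csc A i.castSucc (posIdx k) = A i k := by
  have : (k : ℕ) + 1 ≤ n := k.isLt
  simp [csc, posIdx, this]

@[simp] lemma csc_castSucc_negIdx (i : Fin d) (k : Fin n) :
    csc A i.castSucc (negIdx k) = -A i k := by
  have h : ¬ (n + (k : ℕ) + 1 ≤ n) := by omega
  have h2 : n + (k : ℕ) + 1 - n - 1 = k := by omega
  simp [csc, negIdx, h, h2]

lemma colMonoid_subset {m : ℕ} (B : Matrix (Fin m) (Fin n) ℤ) :
    (colMonoid B : Set (Fin m → ℤ)) ⊆ (colLattice B : Set (Fin m → ℤ)) ∩ colQNonneg B := by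
  intro y hy
  refine AddSubmonoid.closure_induction
    (motive := fun y _ => y ∈ (colLattice B : Set (Fin m → ℤ)) ∩ colQNonneg B) ?_ ?_ ?_ hy
  · rintro _ ⟨j, rfl⟩
    refine ⟨AddSubgroup.subset_closure ⟨j, rfl⟩, Pi.single j 1, ?_, ?_⟩
    · intro k
      rw [Pi.single_apply]
      split_ifs <;> norm_num
    · intro i
      simp [Pi.single_apply]
  · exact ⟨AddSubgroup.zero_mem _, 0, by simp, by simp⟩
  · rintro y z _ _ ⟨hy, r, hr, hry⟩ ⟨hz, s, hs, hsz⟩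
    refine ⟨AddSubgroup.add_mem _ hy hz, r + s, fun j => add_nonneg (hr j) (hs j), fun i => ?_⟩
    simp [hry, hsz, add_mul, Finset.sum_add_distrib]

/-- Rational points of the cone of `A^±` are the points `(A r, m)` with `‖r‖₁ ≤ m`. -/
lemma mem_colQNonneg_csc (y : Fin (d + 1) → ℤ) :
    y ∈ colQNonneg (csc A) ↔ ∃ r : Fin n → ℚ, ∑ k, |r k| ≤ y (Fin.last d) ∧
      ∀ i : Fin d, (y i.castSucc : ℚ) = ∑ k, r k * A i k := by
  constructor
  · rintro ⟨s, hs, hy⟩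
    refine ⟨fun k => s (posIdx k) - s (negIdx k), ?_, fun i => ?_⟩
    · rw [hy, sum_index]
      simp only [csc_last, Int.cast_one, mul_one]
      rw [← Finset.sum_add_distrib]
      refine le_add_of_nonneg_of_le (hs 0) (Finset.sum_le_sum fun k _ => ?_)
      rw [abs_le]
      constructor <;> linarith [hs (posIdx k), hs (negIdx k)]
    · rw [hy, sum_index]
      simp [sub_mul, ← sub_eq_add_neg]
  · rintro ⟨r, hr, hy⟩
    refine ⟨fun j => if h0 : j = 0 then y (Fin.last d) - ∑ k, |r k| else
      if h : (j : ℕ) - 1 < n then max (r ⟨j - 1, h⟩) 0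
      else max (-r ⟨j - n - 1, by
        have := j.isLt
        have : (j : ℕ) ≠ 0 := fun h => h0 (Fin.ext h)
        omega⟩) 0, fun j => ?_, ?_⟩
    · dsimp only
      split_ifs
      · linarith
      · exact le_max_right _ _
      · exact le_max_right _ _
    · have hp : ∀ k : Fin n, posIdx k ≠ 0 := fun k h => by simp [posIdx, Fin.ext_iff] at h
      have hn : ∀ k : Fin n, negIdx k ≠ 0 := fun k h => by simp [negIdx, Fin.ext_iff] at h
      have hp' : ∀ k : Fin n, ((posIdx k : Fin (2 * n + 1)) : ℕ) - 1 = k := fun k => by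
        simp [posIdx]
      have hn' : ∀ k : Fin n, ((negIdx k : Fin (2 * n + 1)) : ℕ) - n - 1 = k := fun k => by
        simp only [negIdx]; omega
      have hn'' : ∀ k : Fin n, ¬ ((negIdx k : Fin (2 * n + 1)) : ℕ) - 1 < n := fun k => by
        simp only [negIdx]; omega
      intro i
      rw [sum_index]
      simp only [hp, hn, hp', hn', hn'', Fin.isLt, dite_true, dite_false,
        Fin.eta]
      induction i using Fin.lastCases with
      | last =>
        simp only [csc_last, Int.cast_one, mul_one, ← Finset.sum_add_distrib]
        rw [sub_add_eq_add_sub, add_sub_assoc, ← Finset.sum_sub_distrib]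
        simp only [max_zero_add_max_neg_zero_eq_abs_self, sub_self, Finset.sum_const_zero,
          add_zero]
      | cast i =>
        rw [hy]
        simp only [csc_castSucc_zero, csc_castSucc_posIdx, csc_castSucc_negIdx, Int.cast_zero,
          mul_zero, zero_add, ← Finset.sum_add_distrib, Int.cast_neg]
        refine Finset.sum_congr rfl fun k _ => ?_
        rcases le_total (r k) 0 with h | h
        · rw [max_eq_right h, max_eq_left (by linarith)]; ring
        · rw [max_eq_left h, max_eq_right (by linarith)]; ring

lemma mem_colLattice_csc (y : Fin (d + 1) → ℤ) (r : Fin n → ℤ)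
    (hy : ∀ i : Fin d, y i.castSucc = ∑ k, r k * A i k) : y ∈ colLattice (csc A) := by
  have hcol : ∀ j, (fun i => csc A i j) ∈ colLattice (csc A) :=
    fun j => AddSubgroup.subset_closure ⟨j, rfl⟩
  have : y = (y (Fin.last d) - ∑ k, r k) • (fun i => csc A i 0) +
      ∑ k, r k • (fun i => csc A i (posIdx k)) := by
    ext i
    induction i using Fin.lastCases with
    | last => simp
    | cast i => simp [hy]
  rw [this]
  exact add_mem (zsmul_mem (hcol _) _) (sum_mem fun k _ => zsmul_mem (hcol _) _)

lemma mem_colMonoid_csc (y : Fin (d + 1) → ℤ) (r : Fin n → ℤ)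
    (hr : ∑ k, |r k| ≤ y (Fin.last d))
    (hy : ∀ i : Fin d, y i.castSucc = ∑ k, r k * A i k) : y ∈ colMonoid (csc A) := by
  have hcol : ∀ j, (fun i => csc A i j) ∈ colMonoid (csc A) :=
    fun j => AddSubmonoid.subset_closure ⟨j, rfl⟩
  have : y = (y (Fin.last d) - ∑ k, |r k|).toNat • (fun i => csc A i 0) +
      ∑ k, (r k).natAbs • (fun i => csc A i (if 0 ≤ r k then posIdx k else negIdx k)) := by
    ext i
    induction i using Fin.lastCases with
    | last =>
      simp [Int.toNat_of_nonneg (sub_nonneg.2 hr)]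
    | cast i =>
      simp only [hy, Pi.add_apply, Pi.smul_apply, csc_castSucc_zero, smul_zero, zero_add,
        Finset.sum_apply]
      refine Finset.sum_congr rfl fun k _ => ?_
      split_ifs with h
      · simp [abs_of_nonneg h]
      · simp [abs_of_neg (not_le.1 h)]
  rw [this]
  exact add_mem (nsmul_mem (hcol _) _) (sum_mem fun k _ => nsmul_mem (hcol _) _)

end Columns

section Rounding

/-- The set of indices at which a rational vector is not integral. -/
def fracSupport (r : Fin n → ℚ) : Finset (Fin n) :=
  Finset.univ.filter fun k => Int.fract (r k) ≠ 0

lemma mem_fracSupport {r : Fin n → ℚ} {k : Fin n} :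
    k ∈ fracSupport r ↔ Int.fract (r k) ≠ 0 := by
  simp [fracSupport]

lemma exists_int_eq_of_notMem_fracSupport {r : Fin n → ℚ} {k : Fin n}
    (h : k ∉ fracSupport r) : ∃ c : ℤ, (c : ℚ) = r k := by
  rw [mem_fracSupport, not_not, Int.fract_eq_zero_iff] at h
  exact h

lemma notMem_fracSupport_of_eq_int {r : Fin n → ℚ} {k : Fin n} {c : ℤ}
    (h : r k = c) : k ∉ fracSupport r := by
  simp [mem_fracSupport, h]

lemma abs_eq_sign_mul_of_floor_le_of_le_ceil {a b : ℚ} (h₁ : (⌊a⌋ : ℚ) ≤ b)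
    (h₂ : b ≤ ⌈a⌉) : |b| = SignType.sign a * b := by
  rcases lt_trichotomy a 0 with ha | rfl | ha
  · have : (⌈a⌉ : ℚ) ≤ 0 := by exact_mod_cast Int.ceil_le.2 (by simpa using ha.le)
    rw [sign_neg ha, abs_of_nonpos (h₂.trans this)]
    simp
  · have : b = 0 := le_antisymm (by simpa using h₂) (by simpa using h₁)
    simp [this]
  · have : (0 : ℚ) ≤ ⌊a⌋ := by exact_mod_cast Int.floor_nonneg.2 ha.le
    rw [sign_pos ha, abs_of_nonneg (this.trans h₁)]
    simp

/-- Moving along a direction supported on the non-integral coordinates which does not increase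
the `ℓ¹`-norm to first order, until a further coordinate becomes integral. -/
lemma exists_fracSupport_ssubset (r z : Fin n → ℚ) (hz : z ≠ 0)
    (hsupp : ∀ k, k ∉ fracSupport r → z k = 0)
    (hsign : ∑ k, (SignType.sign (r k) : ℚ) * z k ≤ 0) :
    ∃ t : ℚ, ∑ k, |r k + t * z k| ≤ ∑ k, |r k| ∧
      fracSupport (fun k => r k + t * z k) ⊂ fracSupport r := by
  classical
  let τ : Fin n → ℚ := fun k =>
    if 0 < z k then (⌈r k⌉ - r k) / z k else (⌊r k⌋ - r k) / z k
  obtain ⟨k₁, hk₁⟩ : ∃ k, z k ≠ 0 := Function.ne_iff.1 hz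
  obtain ⟨k₀, hk₀, hmin⟩ := (Finset.univ.filter fun k => z k ≠ 0).exists_min_image τ
    ⟨k₁, by simpa using hk₁⟩
  simp only [Finset.mem_filter, Finset.mem_univ, true_and] at hk₀ hmin
  have hfl : ∀ k, (⌊r k⌋ : ℚ) ≤ r k := fun k => Int.floor_le _
  have hce : ∀ k, r k ≤ (⌈r k⌉ : ℚ) := fun k => Int.le_ceil _
  have hτ : 0 ≤ τ k₀ := by
    dsimp only [τ]
    split_ifs with h
    · exact div_nonneg (by linarith [hce k₀]) h.le
    · exact div_nonneg_of_nonpos (by linarith [hfl k₀]) (not_lt.1 h)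
  have hbounds : ∀ k, (⌊r k⌋ : ℚ) ≤ r k + τ k₀ * z k ∧ r k + τ k₀ * z k ≤ ⌈r k⌉ := by
    intro k
    by_cases hzk : z k = 0
    · simp [hzk, hfl, hce]
    have h := hmin k hzk
    rcases lt_or_gt_of_ne hzk with hneg | hpos
    · have e : τ k = (⌊r k⌋ - r k) / z k := if_neg hneg.not_gt
      rw [e, le_div_iff_of_neg hneg] at h
      have := mul_nonpos_of_nonneg_of_nonpos hτ hneg.le
      exact ⟨by linarith, by linarith [hce k]⟩
    · have e : τ k = (⌈r k⌉ - r k) / z k := if_pos hpos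
      rw [e, le_div_iff₀ hpos] at h
      have := mul_nonneg hτ hpos.le
      exact ⟨by linarith [hfl k], by linarith⟩
  refine ⟨τ k₀, ?_, Finset.ssubset_iff_subset_ne.2 ⟨fun k hk => ?_, fun heq => ?_⟩⟩
  · have h1 : ∀ k, |r k + τ k₀ * z k| = |r k| + τ k₀ * (SignType.sign (r k) * z k) := by
      intro k
      rw [abs_eq_sign_mul_of_floor_le_of_le_ceil (hbounds k).1 (hbounds k).2,
        abs_eq_sign_mul_of_floor_le_of_le_ceil (hfl k) (hce k)]
      ring
    simp only [h1, Finset.sum_add_distrib, ← Finset.mul_sum]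
    have := mul_nonpos_of_nonneg_of_nonpos hτ hsign
    linarith
  · by_contra hk'
    rw [mem_fracSupport, hsupp k hk', mul_zero, add_zero, ← mem_fracSupport] at hk
    exact hk' hk
  · have hmem : k₀ ∈ fracSupport r := by
      by_contra h
      exact hk₀ (hsupp k₀ h)
    rw [← heq] at hmem
    refine absurd hmem ?_
    by_cases h : 0 < z k₀
    · refine notMem_fracSupport_of_eq_int (c := ⌈r k₀⌉) ?_
      simp only [τ, if_pos h]
      field_simp
      ring
    · refine notMem_fracSupport_of_eq_int (c := ⌊r k₀⌋) ?_
      simp only [τ, if_neg h]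
      field_simp
      ring

/-- Every rational representation can be replaced by one of no larger `ℓ¹`-norm whose
non-integral coordinates index linearly independent columns. -/
lemma exists_independent_fracSupport (A : Matrix (Fin d) (Fin n) ℤ) (r : Fin n → ℚ) :
    ∃ s : Fin n → ℚ, ∑ k, |s k| ≤ ∑ k, |r k| ∧
      (∀ i, ∑ k, s k * (A i k : ℚ) = ∑ k, r k * (A i k : ℚ)) ∧
      ∀ z : Fin n → ℚ, (∀ k, k ∉ fracSupport s → z k = 0) →
        (∀ i, ∑ k, z k * (A i k : ℚ) = 0) → z = 0 := by
  induction hF : fracSupport r using Finset.strongInduction generalizing r with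
  | H F ih =>
    subst hF
    by_cases hind : ∀ z : Fin n → ℚ, (∀ k, k ∉ fracSupport r → z k = 0) →
        (∀ i, ∑ k, z k * (A i k : ℚ) = 0) → z = 0
    · exact ⟨r, le_rfl, fun _ => rfl, hind⟩
    push Not at hind
    obtain ⟨z, hsupp, hker, hz⟩ := hind
    obtain ⟨z, hsupp, hker, hz, hsign⟩ : ∃ z : Fin n → ℚ,
        (∀ k, k ∉ fracSupport r → z k = 0) ∧ (∀ i, ∑ k, z k * (A i k : ℚ) = 0) ∧ z ≠ 0 ∧
        ∑ k, (SignType.sign (r k) : ℚ) * z k ≤ 0 := by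
      rcases le_total (∑ k, (SignType.sign (r k) : ℚ) * z k) 0 with h | h
      · exact ⟨z, hsupp, hker, hz, h⟩
      · refine ⟨-z, fun k hk => by simp [hsupp k hk], fun i => by simp [hker i],
          neg_ne_zero.2 hz, by simpa using h⟩
    obtain ⟨t, hnorm, hss⟩ := exists_fracSupport_ssubset r z hz hsupp hsign
    obtain ⟨s, hs, hsA, hsind⟩ := ih _ hss _ rfl
    refine ⟨s, hs.trans hnorm, fun i => ?_, hsind⟩
    simp only [hsA, add_mul, mul_assoc, Finset.sum_add_distrib, ← Finset.mul_sum, hker,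
      mul_zero, add_zero]

end Rounding

section EdgeMatrix

variable (v w : Fin n → Fin d)

lemma edgeMatrix_mulVec_single (k : Fin n) :
    (edgeMatrix v w).mulVec (Pi.single k 1) = Pi.single (v k) 1 + Pi.single (w k) 1 := by
  ext i
  simp [edgeMatrix, Pi.single_apply]

lemma edgeMatrix_mulVec_single_of_eq {k : Fin n} {a b : Fin d} (h : s(v k, w k) = s(a, b)) :
    (edgeMatrix v w).mulVec (Pi.single k 1) = Pi.single a 1 + Pi.single b 1 := by
  rw [edgeMatrix_mulVec_single]
  rcases Sym2.eq_iff.1 h with ⟨h1, h2⟩ | ⟨h1, h2⟩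
  · rw [h1, h2]
  · rw [h1, h2, add_comm]

lemma sum_edgeMatrix (k : Fin n) : ∑ i, edgeMatrix v w i k = 2 := by
  simp [edgeMatrix, Finset.sum_add_distrib]

lemma even_sum_of_mem_colLattice {y : Fin (d + 1) → ℤ}
    (hy : y ∈ colLattice (csc (edgeMatrix v w))) : Even (∑ i : Fin d, y i.castSucc) := by
  refine AddSubgroup.closure_induction
    (p := fun y _ => Even (∑ i : Fin d, y i.castSucc)) ?_ ?_ ?_ ?_ hy
  · rintro _ ⟨j, rfl⟩
    rcases eq_zero_or_posIdx_or_negIdx j with rfl | ⟨k, rfl⟩ | ⟨k, rfl⟩ <;>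
      simp [sum_edgeMatrix]
  · simp
  · intro x y _ _ hx hy
    simpa [Finset.sum_add_distrib] using hx.add hy
  · intro x _ hx
    simpa using hx

variable {v w} {H : SimpleGraph (Fin d)}

/-- The alternating sum of the edges of a walk. -/
lemma exists_alternating (hH : ∀ i j, H.Adj i j → ∃ k, s(v k, w k) = s(i, j))
    {a b : Fin d} (p : H.Walk a b) :
    ∃ g : Fin n → ℤ, (∀ k, s(v k, w k) ∉ p.edges → g k = 0) ∧
      (edgeMatrix v w).mulVec g = Pi.single a 1 - (-1) ^ p.length • Pi.single b 1 ∧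
      (p.IsTrail → p.length ≠ 0 → g ≠ 0) := by
  induction p with
  | nil => exact ⟨0, by simp, by simp, by simp⟩
  | @cons a b c h p ih =>
    obtain ⟨g, hsupp, hg, -⟩ := ih
    obtain ⟨k₀, hk₀⟩ := hH _ _ h
    refine ⟨Pi.single k₀ 1 - g, fun k hk => ?_, ?_, fun ht _ hzero => ?_⟩
    · rw [SimpleGraph.Walk.edges_cons, List.mem_cons, not_or] at hk
      have : k ≠ k₀ := by
        rintro rfl
        exact hk.1 hk₀
      simp [this, hsupp k hk.2]
    · rw [Matrix.mulVec_sub, hg, edgeMatrix_mulVec_single_of_eq v w hk₀,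
        SimpleGraph.Walk.length_cons, pow_succ, mul_neg_one, neg_smul]
      abel
    · have h0 := congrFun hzero k₀
      rw [SimpleGraph.Walk.isTrail_cons] at ht
      rw [Pi.sub_apply, hsupp k₀ (hk₀ ▸ ht.2)] at h0
      simp at h0

/-- The sum of the edges of a walk. -/
lemma exists_edge_count (hH : ∀ i j, H.Adj i j → ∃ k, s(v k, w k) = s(i, j))
    {a b : Fin d} (p : H.Walk a b) :
    ∃ g : Fin n → ℤ, (∀ k, 0 ≤ g k) ∧ ∑ k, g k = p.length ∧
      (edgeMatrix v w).mulVec g + Pi.single a 1 + Pi.single b 1 =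
        fun i => 2 * (p.support.count i : ℤ) := by
  induction p with
  | @nil a =>
    refine ⟨0, by simp, by simp, ?_⟩
    ext i
    by_cases h : i = a
    · subst h; simp
    · simp [h, Ne.symm h]
  | @cons a b c h p ih =>
    obtain ⟨g, hnonneg, hsum, hg⟩ := ih
    obtain ⟨k₀, hk₀⟩ := hH _ _ h
    refine ⟨Pi.single k₀ 1 + g, fun k => add_nonneg ?_ (hnonneg k), ?_, ?_⟩
    · exact (Pi.single_nonneg.2 zero_le_one : (0 : Fin n → ℤ) ≤ Pi.single k₀ 1) k
    · simp [Finset.sum_add_distrib, hsum, add_comm]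
    · have h2 : (edgeMatrix v w).mulVec (Pi.single k₀ 1 + g) + Pi.single a 1 + Pi.single c 1 =
          ((edgeMatrix v w).mulVec g + Pi.single b 1 + Pi.single c 1) + 2 • Pi.single a 1 := by
        rw [Matrix.mulVec_add, edgeMatrix_mulVec_single_of_eq v w hk₀, two_smul]
        abel
      rw [h2, hg]
      ext i
      by_cases h : i = a
      · subst h; simp; ring
      · simp [h, Ne.symm h]

/-- The edge vectors of a connected graph with an odd closed walk generate all integer vectors
with even coordinate sum. -/
lemma exists_mulVec_eq_of_even (hconn : H.Connected)
    (hH : ∀ i j, H.Adj i j → ∃ k, s(v k, w k) = s(i, j))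
    {a : Fin d} (p : H.Walk a a) (hp : Odd p.length) {x : Fin d → ℤ} (hx : Even (∑ i, x i)) :
    ∃ g : Fin n → ℤ, (edgeMatrix v w).mulVec g = x := by
  let L := LinearMap.range (edgeMatrix v w).mulVecLin
  have h2 : (2 : ℤ) • (Pi.single a 1 : Fin d → ℤ) ∈ L := by
    obtain ⟨g, -, hg, -⟩ := exists_alternating hH p
    refine ⟨g, ?_⟩
    rw [Matrix.mulVecLin_apply, hg, hp.neg_one_pow, neg_smul, sub_neg_eq_add, one_smul, two_smul]
  have hdiff : ∀ i, (Pi.single i 1 - Pi.single a 1 : Fin d → ℤ) ∈ L := by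
    intro i
    obtain ⟨q⟩ := hconn.preconnected i a
    obtain ⟨g, -, hg, -⟩ := exists_alternating hH q
    have hmem : (edgeMatrix v w).mulVec g ∈ L := ⟨g, rfl⟩
    rcases Nat.even_or_odd q.length with hq | hq
    · rwa [hg, hq.neg_one_pow, one_smul] at hmem
    · rw [hg, hq.neg_one_pow, neg_smul, sub_neg_eq_add, one_smul] at hmem
      convert L.sub_mem hmem h2 using 1
      rw [two_smul]
      abel
  obtain ⟨c, hc⟩ := hx
  have hxL : x ∈ L := by
    have hsum : x = ∑ i, x i • (Pi.single i 1 - Pi.single a 1 : Fin d → ℤ) +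
        c • (2 : ℤ) • (Pi.single a 1 : Fin d → ℤ) := by
      simp only [smul_sub, Finset.sum_sub_distrib, ← Finset.sum_smul, hc]
      have : ∑ i, x i • (Pi.single i 1 : Fin d → ℤ) = x := by
        ext j
        simp [Finset.sum_apply, Pi.single_apply]
      rw [this, smul_smul, mul_two, sub_add_cancel]
    rw [hsum]
    exact L.add_mem (L.sum_mem fun i _ => L.smul_mem _ (hdiff i)) (L.smul_mem _ h2)
  obtain ⟨g, hg⟩ := hxL
  exact ⟨g, by simpa using hg⟩

lemma mem_tail_support_iff {a : Fin d} {p : H.Walk a a} (hp : ¬p.Nil) {i : Fin d} :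
    i ∈ p.support.tail ↔ i ∈ p.support := by
  rw [SimpleGraph.Walk.mem_support_iff]
  refine ⟨Or.inr, ?_⟩
  rintro (rfl | h)
  · exact SimpleGraph.Walk.end_mem_tail_support hp
  · exact h

/-- The edges of a cycle add up to twice the indicator vector of its vertex set. -/
lemma exists_edge_count_of_isCycle (hH : ∀ i j, H.Adj i j → ∃ k, s(v k, w k) = s(i, j))
    {a : Fin d} {p : H.Walk a a} (hp : p.IsCycle) :
    ∃ g : Fin n → ℤ, (∀ k, 0 ≤ g k) ∧ ∑ k, g k = p.length ∧
      ∀ i, (edgeMatrix v w).mulVec g i = if i ∈ p.support then 2 else 0 := by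
  obtain ⟨g, hnonneg, hsum, hg⟩ := exists_edge_count hH p
  refine ⟨g, hnonneg, hsum, fun i => ?_⟩
  have h := congrFun hg i
  rw [← SimpleGraph.Walk.cons_tail_support p, List.count_cons, hp.support_nodup.count] at h
  simp only [Pi.add_apply, Pi.single_apply, beq_iff_eq, eq_comm (a := a)] at h
  simp only [← mem_tail_support_iff hp.not_nil]
  split_ifs at h ⊢ <;> push_cast at h <;> linarith

lemma card_filter_mem_support_of_isCycle {a : Fin d} {p : H.Walk a a} (hp : p.IsCycle) :
    (Finset.univ.filter fun i => i ∈ p.support).card = p.length := by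
  have h : p.support.tail.length = p.length := by simp
  rw [← h, ← List.toFinset_card_of_nodup hp.support_nodup]
  congr 1
  ext i
  simp [mem_tail_support_iff hp.not_nil]

end EdgeMatrix

section Necessity

variable {v w : Fin n → Fin d}

lemma sum_finset_edgeMatrix (v w : Fin n → Fin d) (S : Finset (Fin d)) (k : Fin n) :
    ∑ i ∈ S, edgeMatrix v w i k = (if v k ∈ S then 1 else 0) + if w k ∈ S then 1 else 0 := by
  simp [edgeMatrix, Finset.sum_add_distrib]

/-- A supporting functional of `A^±` attached to two disjoint vertex sets, with a parity
restriction on the face which it cuts out. -/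
lemma sum_sub_sum_le_of_mem_colMonoid {S T : Finset (Fin d)} (hST : Disjoint S T)
    {y : Fin (d + 1) → ℤ} (hy : y ∈ colMonoid (csc (edgeMatrix v w))) :
    ∑ i ∈ S, y i.castSucc - ∑ i ∈ T, y i.castSucc ≤ 2 * y (Fin.last d) ∧
      (∑ i ∈ S, y i.castSucc - ∑ i ∈ T, y i.castSucc = 2 * y (Fin.last d) →
        Even (∑ i ∈ S, y i.castSucc)) := by
  refine AddSubmonoid.closure_induction (motive := fun y _ =>
    ∑ i ∈ S, y i.castSucc - ∑ i ∈ T, y i.castSucc ≤ 2 * y (Fin.last d) ∧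
      (∑ i ∈ S, y i.castSucc - ∑ i ∈ T, y i.castSucc = 2 * y (Fin.last d) →
        Even (∑ i ∈ S, y i.castSucc))) ?_ ?_ ?_ hy
  · rintro _ ⟨j, rfl⟩
    have hdisj : ∀ i, i ∈ T → i ∉ S := fun i h h' => Finset.disjoint_left.1 hST h' h
    rcases eq_zero_or_posIdx_or_negIdx j with rfl | ⟨k, rfl⟩ | ⟨k, rfl⟩
    · simp
    · simp only [csc_castSucc_posIdx, sum_finset_edgeMatrix, csc_last]
      split_ifs <;> simp
    · simp only [csc_castSucc_negIdx, Finset.sum_neg_distrib, sum_finset_edgeMatrix, csc_last]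
      have h1 := hdisj (v k)
      have h2 := hdisj (w k)
      split_ifs <;> simp_all
  · simp
  · rintro x y _ _ ⟨hx, hx'⟩ ⟨hy, hy'⟩
    simp only [Pi.add_apply, Finset.sum_add_distrib]
    exact ⟨by linarith, fun h => (hx' (by linarith)).add (hy' (by linarith))⟩

lemma exists_common_vertex_of_isNormalConfig {G : SimpleGraph (Fin d)} (hconn : G.Connected)
    (hG : ∀ i j, G.Adj i j → ∃ k, s(v k, w k) = s(i, j))
    (hnormal : IsNormalConfig (csc (edgeMatrix v w)))
    {a b : Fin d} {p : G.Walk a a} {q : G.Walk b b} (hp : p.IsCycle) (hq : q.IsCycle)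
    (hpodd : Odd p.length) (hqodd : Odd q.length) : ∃ x, x ∈ p.support ∧ x ∈ q.support := by
  by_contra! hdisj
  set S := Finset.univ.filter fun i => i ∈ p.support with hS
  set T := Finset.univ.filter fun i => i ∈ q.support with hT
  have hST : Disjoint S T := Finset.disjoint_left.2 fun i hi hi' =>
    hdisj i (by simpa [hS] using hi) (by simpa [hT] using hi')
  have hSc : S.card = p.length := card_filter_mem_support_of_isCycle hp
  have hTc : T.card = q.length := card_filter_mem_support_of_isCycle hq
  obtain ⟨m, hm⟩ := hpodd.add_odd hqodd
  let x : Fin d → ℤ := fun i => (if i ∈ S then 1 else 0) - if i ∈ T then 1 else 0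
  let y : Fin (d + 1) → ℤ := Fin.snoc (α := fun _ => ℤ) x m
  have hylast : y (Fin.last d) = m := Fin.snoc_last (α := fun _ => ℤ) _ _
  have hycast : ∀ i : Fin d, y i.castSucc = x i :=
    fun i => Fin.snoc_castSucc (α := fun _ => ℤ) _ _ _
  have hxsum : ∑ i, x i = (S.card : ℤ) - T.card := by
    simp [x, Finset.sum_sub_distrib]
  have hxS : ∑ i ∈ S, x i = S.card := by
    simp [x, Finset.sum_sub_distrib, Finset.disjoint_iff_inter_eq_empty.1 hST]
  have hxT : ∑ i ∈ T, x i = -T.card := by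
    simp [x, Finset.sum_sub_distrib, Finset.disjoint_iff_inter_eq_empty.1 hST.symm]
  have hlattice : y ∈ colLattice (csc (edgeMatrix v w)) := by
    obtain ⟨g, hg⟩ := exists_mulVec_eq_of_even hconn hG p hpodd (x := x) (by
      rw [hxsum, hSc, hTc]
      exact ((Int.odd_coe_nat _).2 hpodd).sub_odd ((Int.odd_coe_nat _).2 hqodd))
    refine mem_colLattice_csc _ y g fun i => ?_
    rw [hycast, ← hg, Matrix.mulVec, dotProduct]
    exact Finset.sum_congr rfl fun k _ => mul_comm _ _
  have hcone : y ∈ colQNonneg (csc (edgeMatrix v w)) := by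
    obtain ⟨g, hg0, hgsum, hg⟩ := exists_edge_count_of_isCycle hG hp
    obtain ⟨h, hh0, hhsum, hh⟩ := exists_edge_count_of_isCycle hG hq
    refine (mem_colQNonneg_csc _ _).2 ⟨fun k => ((g k : ℚ) - h k) / 2, ?_, fun i => ?_⟩
    · have h1 : ∀ k, |((g k : ℚ) - h k) / 2| ≤ ((g k : ℚ) + h k) / 2 := fun k => by
        have h3 : (0 : ℚ) ≤ g k := by exact_mod_cast hg0 k
        have h4 : (0 : ℚ) ≤ h k := by exact_mod_cast hh0 k
        rw [abs_le]
        constructor <;> linarith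
      refine (Finset.sum_le_sum fun k _ => h1 k).trans ?_
      have h2 : ((∑ k, g k : ℤ) : ℚ) + (∑ k, h k : ℤ) = 2 * m := by
        rw [hgsum, hhsum]
        exact_mod_cast hm.trans (two_mul m).symm
      rw [hylast, ← Finset.sum_div, Finset.sum_add_distrib]
      push_cast at h2 ⊢
      linarith
    · have h1 : (∑ k, ((g k : ℚ) - h k) / 2 * edgeMatrix v w i k) =
          (((edgeMatrix v w).mulVec g i - (edgeMatrix v w).mulVec h i : ℤ) : ℚ) / 2 := by
        simp only [Matrix.mulVec, dotProduct, ← Finset.sum_sub_distrib]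
        push_cast
        rw [Finset.sum_div]
        exact Finset.sum_congr rfl fun k _ => by ring
      rw [h1, hg, hh, hycast]
      simp only [x, hS, hT, Finset.mem_filter, Finset.mem_univ, true_and]
      split_ifs <;> norm_num
  have hmem : y ∈ (colMonoid (csc (edgeMatrix v w)) : Set (Fin (d + 1) → ℤ)) := by
    rw [hnormal]
    exact ⟨hlattice, hcone⟩
  have heven := (sum_sub_sum_le_of_mem_colMonoid hST hmem).2
  simp only [hycast, hylast, hxS, hxT, hSc, hTc] at heven
  have := heven (by push_cast [sub_neg_eq_add]; exact_mod_cast hm.trans (two_mul m).symm)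
  rw [Int.even_coe_nat] at this
  exact (Nat.not_even_iff_odd.2 hpodd) this

end Necessity

section Sufficiency

variable {v w : Fin n → Fin d}

lemma edgeMatrix_apply_of_ne {k : Fin n} (hk : v k ≠ w k) (i : Fin d) :
    edgeMatrix v w i k = if i ∈ s(v k, w k) then 1 else 0 := by
  simp only [edgeMatrix, Matrix.of_apply, Sym2.mem_iff]
  by_cases h : i = v k
  · subst h
    simp [hk]
  · simp [h]

/-- The graph formed by the edges with index in `F`. -/
def edgeSubgraph (v w : Fin n → Fin d) (F : Finset (Fin n)) : SimpleGraph (Fin d) :=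
  SimpleGraph.fromEdgeSet {e | ∃ k ∈ F, s(v k, w k) = e}

/-- The vertices incident with an edge with index in `F`. -/
def vertexSupport (v w : Fin n → Fin d) (F : Finset (Fin n)) : Finset (Fin d) :=
  Finset.univ.filter fun i => ∃ k ∈ F, i ∈ s(v k, w k)

/-- The indices in `F` of the edges incident with `i`. -/
def incidence (v w : Fin n → Fin d) (F : Finset (Fin n)) (i : Fin d) : Finset (Fin n) :=
  F.filter fun k => i ∈ s(v k, w k)

variable {F : Finset (Fin n)}

lemma mem_vertexSupport {i : Fin d} :
    i ∈ vertexSupport v w F ↔ ∃ k ∈ F, i ∈ s(v k, w k) := by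
  simp [vertexSupport]

lemma mem_incidence {i : Fin d} {k : Fin n} :
    k ∈ incidence v w F i ↔ k ∈ F ∧ i ∈ s(v k, w k) := by
  simp [incidence]

lemma edgeSubgraph_adj {i j : Fin d} :
    (edgeSubgraph v w F).Adj i j ↔ (∃ k ∈ F, s(v k, w k) = s(i, j)) ∧ i ≠ j := by
  simp [edgeSubgraph, SimpleGraph.fromEdgeSet_adj]

lemma mem_vertexSupport_of_adj {i j : Fin d} (h : (edgeSubgraph v w F).Adj i j) :
    i ∈ vertexSupport v w F := by
  obtain ⟨⟨k, hk, he⟩, -⟩ := edgeSubgraph_adj.1 h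
  exact mem_vertexSupport.2 ⟨k, hk, he ▸ Sym2.mem_mk_left i j⟩

lemma neighborSet_nonempty (hne : ∀ k, v k ≠ w k) {i : Fin d} (hi : i ∈ vertexSupport v w F) :
    ((edgeSubgraph v w F).neighborSet i).Nonempty := by
  obtain ⟨k, hk, hmem⟩ := mem_vertexSupport.1 hi
  obtain ⟨j, hj⟩ := hmem
  refine ⟨j, edgeSubgraph_adj.2 ⟨⟨k, hk, hj⟩, ?_⟩⟩
  rintro rfl
  have := Sym2.mk_isDiag_iff.2 (rfl : i = i)
  rw [← hj] at this
  exact hne k (Sym2.mk_isDiag_iff.1 this)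

lemma sum_card_incidence (hne : ∀ k, v k ≠ w k) :
    ∑ i ∈ vertexSupport v w F, (incidence v w F i).card = 2 * F.card := by
  have h : ∀ k ∈ F, ((vertexSupport v w F).filter fun i => i ∈ s(v k, w k)).card = 2 := by
    intro k hk
    rw [← Finset.card_pair (hne k)]
    congr 1
    ext i
    simp only [Finset.mem_filter, mem_vertexSupport, Finset.mem_insert, Finset.mem_singleton,
      Sym2.mem_iff, and_iff_right_iff_imp]
    exact fun hi => ⟨k, hk, hi⟩
  have h2 := Finset.sum_card_bipartiteAbove_eq_sum_card_bipartiteBelow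
    (s := vertexSupport v w F) (t := F) (fun i k => i ∈ s(v k, w k))
  refine h2.trans ((Finset.sum_congr rfl h).trans ?_)
  rw [Finset.sum_const, smul_eq_mul, mul_comm]

/-- Linearly independent edges do not outnumber their vertices. -/
lemma card_le_card_vertexSupport (hne : ∀ k, v k ≠ w k)
    (hind : ∀ z : Fin n → ℚ, (∀ k, k ∉ F → z k = 0) →
      (∀ i, ∑ k, z k * (edgeMatrix v w i k : ℚ) = 0) → z = 0) :
    F.card ≤ (vertexSupport v w F).card := by
  let M : Matrix (vertexSupport v w F) F ℚ := fun i k => edgeMatrix v w i k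
  have hM : Function.Injective M.mulVecLin := by
    rw [← LinearMap.ker_eq_bot, LinearMap.ker_eq_bot']
    intro f hf
    have h0 := hind (fun k => if h : k ∈ F then f ⟨k, h⟩ else 0) (fun k hk => dif_neg hk) ?_
    · ext ⟨k, hk⟩
      simpa [hk] using congrFun h0 k
    intro i
    rw [← Finset.sum_subset (Finset.subset_univ F) (fun k _ hk => by simp [hk]),
      ← Finset.sum_coe_sort F]
    by_cases hi : i ∈ vertexSupport v w F
    · have := congrFun hf ⟨i, hi⟩
      rw [Pi.zero_apply] at this
      rw [← this]
      exact Finset.sum_congr rfl fun k _ => by simp [M, mul_comm]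
    · refine Finset.sum_eq_zero fun k _ => ?_
      rw [edgeMatrix_apply_of_ne (hne k), if_neg fun h => hi (mem_vertexSupport.2 ⟨k, k.2, h⟩)]
      simp
  simpa using LinearMap.finrank_le_finrank_of_injective hM

lemma ncard_neighborSet_edgeSubgraph (hne : ∀ k, v k ≠ w k)
    (hinj : Function.Injective fun k => s(v k, w k)) (i : Fin d) :
    ((edgeSubgraph v w F).neighborSet i).ncard = (incidence v w F i).card := by
  let o : Fin n → Fin d := fun k => if v k = i then w k else v k
  have ho : ∀ k, i ∈ s(v k, w k) → s(v k, w k) = s(i, o k) := by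
    intro k hk
    by_cases h : v k = i
    · simp [o, h]
    · have : w k = i := by
        rcases Sym2.mem_iff.1 hk with h' | h'
        · exact absurd h'.symm h
        · exact h'.symm
      simp [o, h, this, Sym2.eq_swap]
  have hset : (edgeSubgraph v w F).neighborSet i = ((incidence v w F i).image o : Finset _) := by
    ext j
    simp only [SimpleGraph.mem_neighborSet, edgeSubgraph_adj, Finset.coe_image, Set.mem_image,
      Finset.mem_coe, mem_incidence]
    constructor
    · rintro ⟨⟨k, hk, he⟩, -⟩
      have hmem : i ∈ s(v k, w k) := he ▸ Sym2.mem_mk_left i j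
      exact ⟨k, ⟨hk, hmem⟩, Sym2.congr_right.1 ((ho k hmem).symm.trans he)⟩
    · rintro ⟨k, ⟨hk, hmem⟩, rfl⟩
      refine ⟨⟨k, hk, ho k hmem⟩, fun h => hne k ?_⟩
      have he := ho k hmem
      rw [← h] at he
      rcases Sym2.eq_iff.1 he with ⟨h1, h2⟩ | ⟨h1, h2⟩ <;> rw [h1, h2]
  rw [hset, Set.ncard_coe_finset, Finset.card_image_of_injOn]
  intro k hk l hl hkl
  refine hinj ?_
  simp only [Finset.mem_coe, mem_incidence] at hk hl
  simp only [ho k hk.2, ho l hl.2, hkl]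

/-- An alternating edge sum of a walk in `edgeSubgraph v w F` is supported on `F`. -/
lemma eq_zero_of_notMem_edges (hinj : Function.Injective fun k => s(v k, w k))
    {a b : Fin d} (p : (edgeSubgraph v w F).Walk a b) {g : Fin n → ℤ}
    (hg : ∀ k, s(v k, w k) ∉ p.edges → g k = 0) {k : Fin n} (hk : k ∉ F) : g k = 0 := by
  refine hg k fun hmem => hk ?_
  obtain ⟨⟨l, hl, he⟩, -⟩ := edgeSubgraph_adj.1
    (SimpleGraph.mem_edgeSet _ |>.1 (p.edges_subset_edgeSet hmem))
  exact hinj he ▸ hl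

/-- A leafless set of linearly independent edges, any two odd cycles of which meet, is an odd
cycle; it has an odd number of edges and represents twice each of its vertices. -/
lemma odd_card_and_exists_mulVec_eq_two (hne : ∀ k, v k ≠ w k)
    (hinj : Function.Injective fun k => s(v k, w k)) (hF : F.Nonempty)
    (hind : ∀ z : Fin n → ℚ, (∀ k, k ∉ F → z k = 0) →
      (∀ i, ∑ k, z k * (edgeMatrix v w i k : ℚ) = 0) → z = 0)
    (hleaf : ∀ i ∈ vertexSupport v w F, 2 ≤ (incidence v w F i).card)
    (hodd : ∀ (a b : Fin d) (p : (edgeSubgraph v w F).Walk a a)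
      (q : (edgeSubgraph v w F).Walk b b), p.IsCycle → q.IsCycle → Odd p.length →
      Odd q.length → ∃ x, x ∈ p.support ∧ x ∈ q.support) :
    Odd F.card ∧ ∀ u ∈ vertexSupport v w F, ∃ g : Fin n → ℤ, (∀ k, k ∉ F → g k = 0) ∧
      (edgeMatrix v w).mulVec g = 2 • Pi.single u 1 := by
  have hle := card_le_card_vertexSupport hne hind
  have hsum := sum_card_incidence (F := F) hne
  have hsum_le : (vertexSupport v w F).card * 2 ≤ 2 * F.card := by
    rw [← hsum, ← smul_eq_mul]
    exact Finset.card_nsmul_le_sum _ _ _ hleaf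
  have hcard : F.card = (vertexSupport v w F).card := by omega
  have hdeg : ∀ i ∈ vertexSupport v w F, 2 = (incidence v w F i).card := by
    rw [← Finset.sum_eq_sum_iff_of_le hleaf, hsum, Finset.sum_const, hcard, smul_eq_mul, mul_comm]
  have hcycles : (edgeSubgraph v w F).IsCycles := by
    rintro i ⟨j, hj⟩
    rw [ncard_neighborSet_edgeSubgraph hne hinj]
    exact (hdeg i (mem_vertexSupport_of_adj hj)).symm
  have hH : ∀ i j, (edgeSubgraph v w F).Adj i j → ∃ k, s(v k, w k) = s(i, j) := by
    intro i j h
    obtain ⟨⟨k, -, hk⟩, -⟩ := edgeSubgraph_adj.1 h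
    exact ⟨k, hk⟩
  have hcyc : ∀ u ∈ vertexSupport v w F, ∃ p : (edgeSubgraph v w F).Walk u u, p.IsCycle ∧
      Odd p.length ∧ ∀ x, x ∈ p.support ↔ (edgeSubgraph v w F).Reachable x u := by
    intro u hu
    obtain ⟨p, hp, hverts⟩ := hcycles.exists_cycle_toSubgraph_verts_eq_connectedComponentSupp
      (c := (edgeSubgraph v w F).connectedComponentMk u) rfl (neighborSet_nonempty hne hu)
    refine ⟨p, hp, ?_, fun x => ?_⟩
    · by_contra hev
      rw [Nat.not_odd_iff_even] at hev
      obtain ⟨g, hsupp, hg, hg0⟩ := exists_alternating hH p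
      refine hg0 hp.isTrail (fun h => hp.not_nil (SimpleGraph.Walk.length_eq_zero_iff.1 h)) ?_
      rw [hev.neg_one_pow, one_smul, sub_self] at hg
      have := hind (fun k => (g k : ℚ)) (fun k hk => by
        simp [eq_zero_of_notMem_edges hinj p hsupp hk]) (fun i => by
        have := congrFun hg i
        simp only [Matrix.mulVec, dotProduct, Pi.zero_apply] at this
        rw [← Int.cast_zero, ← this]
        push_cast
        exact Finset.sum_congr rfl fun k _ => mul_comm _ _)
      ext k
      simpa using congrFun this k
    · rw [← SimpleGraph.Walk.mem_verts_toSubgraph, hverts,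
        SimpleGraph.ConnectedComponent.mem_supp_iff, SimpleGraph.ConnectedComponent.eq]
  refine ⟨?_, fun u hu => ?_⟩
  · obtain ⟨k, hk⟩ := hF
    obtain ⟨p, hp, hpodd, hps⟩ :=
      hcyc (v k) (mem_vertexSupport.2 ⟨k, hk, Sym2.mem_mk_left _ _⟩)
    have hV : vertexSupport v w F = Finset.univ.filter fun i => i ∈ p.support := by
      ext i
      simp only [Finset.mem_filter, Finset.mem_univ, true_and]
      refine ⟨fun hi => ?_, fun hi => ?_⟩
      · obtain ⟨q, hq, hqodd, hqs⟩ := hcyc i hi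
        obtain ⟨x, hxp, hxq⟩ := hodd _ _ p q hp hq hpodd hqodd
        exact (hps i).2 (((hqs x).1 hxq).symm.trans ((hps x).1 hxp))
      · obtain ⟨e, he, hie⟩ := (SimpleGraph.Walk.mem_support_iff_exists_mem_edges_of_not_nil
          hp.not_nil).1 hi
        obtain ⟨j, rfl⟩ := hie
        exact mem_vertexSupport_of_adj (p.edges_subset_edgeSet he)
    rwa [hcard, hV, card_filter_mem_support_of_isCycle hp]
  · obtain ⟨p, -, hpodd, -⟩ := hcyc u hu
    obtain ⟨g, hsupp, hg, -⟩ := exists_alternating hH p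
    refine ⟨g, fun k => eq_zero_of_notMem_edges hinj p hsupp, ?_⟩
    rw [hg, hpodd.neg_one_pow, neg_smul, sub_neg_eq_add, one_smul, two_smul]

lemma two_le_card_incidence_fracSupport (hne : ∀ k, v k ≠ w k) {s : Fin n → ℚ} {i : Fin d}
    {c : ℤ} (hc : (c : ℚ) = ∑ k, s k * (edgeMatrix v w i k : ℚ))
    (hi : i ∈ vertexSupport v w (fracSupport s)) :
    2 ≤ (incidence v w (fracSupport s) i).card := by
  by_contra! hlt
  obtain ⟨k, hk, hik⟩ := mem_vertexSupport.1 hi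
  have huniq : ∀ l ∈ incidence v w (fracSupport s) i, l = k := fun l hl =>
    Finset.card_le_one.1 (Nat.le_of_lt_succ hlt) l hl k (mem_incidence.2 ⟨hk, hik⟩)
  let Z := (Int.castAddHom ℚ).range
  have hrest : ∑ l ∈ Finset.univ.erase k, s l * (edgeMatrix v w i l : ℚ) ∈ Z := by
    refine sum_mem fun l hl => ?_
    by_cases hlF : l ∈ fracSupport s
    · have hil : i ∉ s(v l, w l) := fun h =>
        (Finset.mem_erase.1 hl).1 (huniq l (mem_incidence.2 ⟨hlF, h⟩))
      rw [edgeMatrix_apply_of_ne (hne l), if_neg hil, Int.cast_zero, mul_zero]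
      exact Z.zero_mem
    · obtain ⟨e, he⟩ := exists_int_eq_of_notMem_fracSupport hlF
      exact ⟨e * edgeMatrix v w i l, by simp [he]⟩
  have hkZ : s k ∈ Z := by
    have h := Finset.add_sum_erase Finset.univ (fun l => s l * (edgeMatrix v w i l : ℚ))
      (Finset.mem_univ k)
    simp only [edgeMatrix_apply_of_ne (hne k) i, if_pos hik, Int.cast_one, mul_one] at h
    rw [← hc] at h
    rw [eq_sub_of_add_eq h]
    exact Z.sub_mem ⟨c, rfl⟩ hrest
  obtain ⟨e, he⟩ := hkZ
  exact notMem_fracSupport_of_eq_int he.symm hk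

/-- If the edges with index in `F` are linearly independent and represent twice each of their
vertices over `ℤ`, then a rational combination of them which is a lattice point has
half-integral coefficients. -/
lemma exists_int_eq_two_mul {F : Finset (Fin n)} (hne : ∀ k, v k ≠ w k)
    (hind : ∀ z : Fin n → ℚ, (∀ k, k ∉ F → z k = 0) →
      (∀ i, ∑ k, z k * (edgeMatrix v w i k : ℚ) = 0) → z = 0)
    (htwo : ∀ u ∈ vertexSupport v w F, ∃ g : Fin n → ℤ, (∀ k, k ∉ F → g k = 0) ∧
      (edgeMatrix v w).mulVec g = 2 • Pi.single u 1)
    {s : Fin n → ℚ} {c : Fin d → ℤ}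
    (hc : ∀ i, (c i : ℚ) = ∑ k ∈ F, s k * (edgeMatrix v w i k : ℚ)) :
    ∀ k ∈ F, ∃ e : ℤ, (e : ℚ) = 2 * s k := by
  have htwo' : ∀ u, ∃ g : Fin n → ℤ, (∀ k, k ∉ F → g k = 0) ∧
      (u ∈ vertexSupport v w F → (edgeMatrix v w).mulVec g = 2 • Pi.single u 1) := by
    intro u
    by_cases hu : u ∈ vertexSupport v w F
    · obtain ⟨g, hg, hg'⟩ := htwo u hu
      exact ⟨g, hg, fun _ => hg'⟩
    · exact ⟨0, by simp, fun h => absurd h hu⟩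
  choose g hsupp hg using htwo'
  have hc0 : ∀ u, u ∉ vertexSupport v w F → c u = 0 := by
    intro u hu
    rw [← Int.cast_eq_zero (α := ℚ), hc]
    refine Finset.sum_eq_zero fun k hk => ?_
    rw [edgeMatrix_apply_of_ne (hne k), if_neg fun h => hu (mem_vertexSupport.2 ⟨k, hk, h⟩)]
    simp
  have hgq : ∀ u i, (c u : ℚ) * ∑ k, (g u k : ℚ) * (edgeMatrix v w i k : ℚ) =
      if u = i then 2 * (c i : ℚ) else 0 := by
    intro u i
    by_cases hu : u ∈ vertexSupport v w F
    · have h := congrFun (hg u hu) i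
      simp only [Matrix.mulVec, dotProduct, Pi.smul_apply, Pi.single_apply] at h
      have h' : ∑ k, (g u k : ℚ) * (edgeMatrix v w i k : ℚ) = if u = i then 2 else 0 := by
        simp only [eq_comm (a := i)] at h
        rw [← Finset.sum_congr rfl fun k _ => mul_comm (edgeMatrix v w i k : ℚ) (g u k : ℚ)]
        have := congrArg (Int.cast : ℤ → ℚ) h
        push_cast at this
        rw [this]
        split_ifs <;> simp
      rw [h']
      split_ifs with hui
      · rw [hui, mul_comm]
      · simp
    · rw [hc0 u hu]
      split_ifs with hui
      · rw [← hui, hc0 u hu]; simp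
      · simp
  have hz := hind (fun k => (if k ∈ F then 2 * s k else 0) - ∑ u, (c u : ℚ) * g u k)
    (fun k hk => by
      simp [hk, hsupp _ k hk]) (fun i => by
      simp only [sub_mul, Finset.sum_sub_distrib, Finset.sum_mul, ite_mul, zero_mul]
      rw [Finset.sum_comm, ← Finset.sum_filter, Finset.filter_mem_eq_inter, Finset.univ_inter]
      simp only [mul_assoc, ← Finset.mul_sum, hgq, ← hc]
      simp)
  intro k hk
  refine ⟨∑ u, c u * g u k, ?_⟩
  have h := congrFun hz k
  simp only [if_pos hk, Pi.zero_apply] at h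
  push_cast
  linarith

lemma fracSupport_eq_empty (hne : ∀ k, v k ≠ w k)
    (hinj : Function.Injective fun k => s(v k, w k)) {s : Fin n → ℚ}
    (hind : ∀ z : Fin n → ℚ, (∀ k, k ∉ fracSupport s → z k = 0) →
      (∀ i, ∑ k, z k * (edgeMatrix v w i k : ℚ) = 0) → z = 0)
    {x : Fin d → ℤ} (hx : ∀ i, (x i : ℚ) = ∑ k, s k * (edgeMatrix v w i k : ℚ))
    (hxeven : Even (∑ i, x i))
    (hodd : ∀ (a b : Fin d) (p : (edgeSubgraph v w (fracSupport s)).Walk a a)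
      (q : (edgeSubgraph v w (fracSupport s)).Walk b b), p.IsCycle → q.IsCycle →
      Odd p.length → Odd q.length → ∃ x, x ∈ p.support ∧ x ∈ q.support) :
    fracSupport s = ∅ := by
  by_contra hF
  rw [← ne_eq, ← Finset.nonempty_iff_ne_empty] at hF
  obtain ⟨hcard, htwo⟩ := odd_card_and_exists_mulVec_eq_two hne hinj hF hind
    (fun i hi => two_le_card_incidence_fracSupport hne (hx i) hi) hodd
  set F := fracSupport s
  have hint : ∀ k, ∃ e : ℤ, k ∉ F → (e : ℚ) = s k := by
    intro k
    by_cases hk : k ∈ F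
    · exact ⟨0, fun h => absurd hk h⟩
    · obtain ⟨e, he⟩ := exists_int_eq_of_notMem_fracSupport hk
      exact ⟨e, fun _ => he⟩
  choose e he using hint
  have hsplit : ∀ f : Fin n → ℚ, ∑ k, f k = ∑ k ∈ F, f k + ∑ k ∈ Fᶜ, f k :=
    fun f => (Finset.sum_add_sum_compl F f).symm
  have hc : ∀ i, ((x i - ∑ k ∈ Fᶜ, e k * edgeMatrix v w i k : ℤ) : ℚ) =
      ∑ k ∈ F, s k * (edgeMatrix v w i k : ℚ) := by
    intro i
    push_cast
    rw [hx, hsplit, add_sub_assoc, add_eq_left, sub_eq_zero]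
    exact Finset.sum_congr rfl fun k hk => by rw [he k (Finset.mem_compl.1 hk)]
  have hhalf : ∀ k, ∃ f : ℤ, k ∈ F → 2 * s k = 2 * f + 1 := by
    intro k
    by_cases hk : k ∈ F
    · obtain ⟨m, hm⟩ := exists_int_eq_two_mul hne hind htwo hc k hk
      rcases Int.even_or_odd' m with ⟨f, rfl | rfl⟩
      · refine absurd hk (notMem_fracSupport_of_eq_int (c := f) ?_)
        push_cast at hm
        linarith
      · refine ⟨f, fun _ => ?_⟩
        rw [← hm]
        push_cast
        ring
    · exact ⟨0, fun h => absurd h hk⟩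
  choose f hf using hhalf
  obtain ⟨t, ht⟩ := hxeven
  have htotal : ((∑ i, x i : ℤ) : ℚ) = ∑ k, 2 * s k := by
    push_cast
    simp only [hx]
    rw [Finset.sum_comm]
    refine Finset.sum_congr rfl fun k _ => ?_
    rw [← Finset.mul_sum, ← Int.cast_sum, sum_edgeMatrix]
    push_cast
    ring
  have hcompl : ∑ k ∈ Fᶜ, 2 * s k = ∑ k ∈ Fᶜ, 2 * (e k : ℚ) :=
    Finset.sum_congr rfl fun k hk => by rw [he k (Finset.mem_compl.1 hk)]
  rw [hsplit, Finset.sum_congr rfl hf, hcompl, ht] at htotal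
  have hZ : t + t = ∑ k ∈ F, (2 * f k + 1) + ∑ k ∈ Fᶜ, 2 * e k := by exact_mod_cast htotal
  rw [Finset.sum_add_distrib, ← Finset.mul_sum, ← Finset.mul_sum, Finset.sum_const,
    nsmul_eq_mul, mul_one] at hZ
  obtain ⟨l, hl⟩ := hcard
  rw [hl] at hZ
  push_cast at hZ
  omega

lemma isNormalConfig_of_exists_common_vertex {G : SimpleGraph (Fin d)}
    (hadj : ∀ k, G.Adj (v k) (w k)) (hinj : Function.Injective fun k => s(v k, w k))
    (hodd : ∀ (a b : Fin d) (p : G.Walk a a) (q : G.Walk b b), p.IsCycle → q.IsCycle →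
      Odd p.length → Odd q.length → ∃ x, x ∈ p.support ∧ x ∈ q.support) :
    IsNormalConfig (csc (edgeMatrix v w)) := by
  refine Set.Subset.antisymm (colMonoid_subset _) ?_
  rintro y ⟨hlattice, hcone⟩
  obtain ⟨r, hr, hy⟩ := (mem_colQNonneg_csc _ _).1 hcone
  obtain ⟨s, hs, hsA, hind⟩ := exists_independent_fracSupport (edgeMatrix v w) r
  have hle : edgeSubgraph v w (fracSupport s) ≤ G := by
    intro i j h
    obtain ⟨⟨k, -, hk⟩, -⟩ := edgeSubgraph_adj.1 h
    rw [← SimpleGraph.mem_edgeSet, ← hk]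
    exact hadj k
  have hempty : fracSupport s = ∅ := by
    refine fracSupport_eq_empty (fun k => (hadj k).ne) hinj hind (fun i => ?_)
      (even_sum_of_mem_colLattice v w hlattice) fun a b p q hp hq hpodd hqodd => ?_
    · rw [hsA, hy]
    · simpa using hodd a b (p.mapLe hle) (q.mapLe hle) (hp.mapLe hle) (hq.mapLe hle)
        (by simpa using hpodd) (by simpa using hqodd)
  have hint : ∀ k, ∃ e : ℤ, (e : ℚ) = s k := fun k =>
    exists_int_eq_of_notMem_fracSupport (by simp [hempty])
  choose e he using hint
  refine mem_colMonoid_csc _ y e ?_ fun i => ?_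
  · have h := hs.trans hr
    simp only [← he] at h
    exact_mod_cast h
  · have h := (hy i).trans (hsA i).symm
    simp only [← he] at h
    exact_mod_cast h

end Sufficiency

end CentrallySymmetric

/-- **Theorem 3.3 ((i) ⇔ (iv)).** Let `G` be a finite simple connected graph on
`{1,…,d}` whose edges are `e_k = {v k, w k}`, `k = 1,…,n`.  Then the toric ring
`K[(A_G)^±]` is normal if and only if any two odd cycles of `G` have a common
vertex. -/
theorem csc_edgeMatrix_normal_iff (d n : ℕ) (G : SimpleGraph (Fin d))
    (hG : G.Connected)
    (v w : Fin n → Fin d) (hlt : ∀ k, v k < w k)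
    (hadj : ∀ k, G.Adj (v k) (w k))
    (hsurj : ∀ i j : Fin d, G.Adj i j →
      ∃ k, (v k = i ∧ w k = j) ∨ (v k = j ∧ w k = i))
    (hinj : Function.Injective fun k => (v k, w k)) :
    IsNormalConfig (csc (edgeMatrix v w)) ↔
      ∀ (a b : Fin d) (p : G.Walk a a) (q : G.Walk b b),
        p.IsCycle → q.IsCycle → Odd p.length → Odd q.length →
          ∃ x : Fin d, x ∈ p.support ∧ x ∈ q.support := by
  have hG' : ∀ i j, G.Adj i j → ∃ k, s(v k, w k) = s(i, j) := by
    intro i j h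
    obtain ⟨k, hk⟩ := hsurj i j h
    exact ⟨k, Sym2.eq_iff.2 hk⟩
  have hinj' : Function.Injective fun k => s(v k, w k) := by
    intro k l hkl
    rcases Sym2.eq_iff.1 hkl with ⟨h1, h2⟩ | ⟨h1, h2⟩
    · exact hinj (Prod.ext h1 h2)
    · exact absurd (hlt k) (by rw [h1, h2]; exact (hlt l).not_gt)
  exact ⟨fun hnormal _ _ _ _ hp hq hpodd hqodd =>
      CentrallySymmetric.exists_common_vertex_of_isNormalConfig hG hG' hnormal hp hq hpodd hqodd,
    CentrallySymmetric.isNormalConfig_of_exists_common_vertex hadj hinj'⟩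
end
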